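/- arXiv:2303.16547 — 2 statements merged into one kernel-verified Lean document; each statement's English description precedes it below -/
import Mathlib

section
/- Let α = 1 + (3/8)·log₂ 6. For every ε > 0 there exists N such that for all odd n ≥ N, 𝒩₀(n,1) ≤ (1 + ε)·(α + 3/2)·b(n−2, (n+1)/2), where 𝒩₀(n,1) is the binary logarithm of the number of n-variable 1-plateaued Boolean functions obtained by restricting (n+1)-variable bent functions to linear hyperplanes. -/
/-- Inner product on 𝔽₂ⁿ. -/
def ip {n : ℕ} (x y : Fin n → ZMod 2) : ZMod 2 := ∑ i, x i * y i

/-- Walsh–Hadamard transform of a Boolean function. -/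
def walsh {n : ℕ} (f : (Fin n → ZMod 2) → ZMod 2) (y : Fin n → ZMod 2) : ℤ :=
  ∑ x, (-1 : ℤ) ^ (f x + ip x y).val

/-- `f` is bent: all Walsh coefficients are `±2^(n/2)`. -/
def IsBent {n : ℕ} (f : (Fin n → ZMod 2) → ZMod 2) : Prop :=
  ∀ y, walsh f y = 2 ^ (n / 2) ∨ walsh f y = -2 ^ (n / 2)

/-- `b(n,r) = ∑_{i=0}^{r} C(n,i)`: the cardinality of a Hamming ball of radius `r`
in 𝔽₂ⁿ. -/
def ballCard (n r : ℕ) : ℕ := ∑ i ∈ Finset.range (r + 1), n.choose i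

/-- `𝒩₀(n,1)`: the binary logarithm of the number of `n`-variable Boolean functions
obtained by restricting `(n+1)`-variable bent functions to linear hyperplanes
(identified with 𝔽₂ⁿ via a linear isomorphism). -/
noncomputable def logNumRestrictedBent (n : ℕ) : ℝ :=
  Real.logb 2 (Nat.card {g : (Fin n → ZMod 2) → ZMod 2 //
    ∃ (f : (Fin (n + 1) → ZMod 2) → ZMod 2)
      (H : Submodule (ZMod 2) (Fin (n + 1) → ZMod 2))
      (φ : (Fin n → ZMod 2) ≃ₗ[ZMod 2] H),
      IsBent f ∧ Module.finrank (ZMod 2) H = n ∧ ∀ x, g x = f ↑(φ x)})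

namespace BentCount

open Finset

/-- The vector space 𝔽₂ⁿ. -/
abbrev Vec (n : ℕ) := Fin n → ZMod 2

/-- The sign `(-1)^a`. -/
def sgn (a : ZMod 2) : ℤ := (-1) ^ a.val

@[simp] lemma sgn_zero : sgn 0 = 1 := rfl

@[simp] lemma sgn_one : sgn 1 = -1 := rfl

lemma sgn_add (a b : ZMod 2) : sgn (a + b) = sgn a * sgn b := by
  revert a b; decide

lemma sgn_mul_self (a : ZMod 2) : sgn a * sgn a = 1 := by
  revert a; decide

lemma sgn_injective : Function.Injective sgn := by
  intro a b; revert a b; decide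

lemma sgn_eq (a : ZMod 2) : sgn a = 1 - 2 * (a.val : ℤ) := by
  revert a; decide

lemma sum_zmod_two {M : Type*} [AddCommMonoid M] (f : ZMod 2 → M) : ∑ a, f a = f 0 + f 1 :=
  Fin.sum_univ_two f

lemma forall_zmod_two {p : ZMod 2 → Prop} : (∀ a, p a) ↔ p 0 ∧ p 1 :=
  Fin.forall_fin_two

variable {n : ℕ}

lemma ip_add_left (x x' y : Vec n) : ip (x + x') y = ip x y + ip x' y := by
  simp [ip, add_mul, sum_add_distrib]

lemma ip_add_right (x y y' : Vec n) : ip x (y + y') = ip x y + ip x y' := by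
  simp [ip, mul_add, sum_add_distrib]

lemma ip_comm (x y : Vec n) : ip x y = ip y x := by
  simp [ip, mul_comm]

@[simp] lemma ip_zero_left (y : Vec n) : ip 0 y = 0 := by simp [ip]

@[simp] lemma ip_zero_right (x : Vec n) : ip x 0 = 0 := by simp [ip]

lemma ip_smul_right (c : ZMod 2) (x y : Vec n) : ip x (c • y) = c * ip x y := by
  simp [ip, mul_sum, mul_left_comm]

lemma add_self_vec (x : Vec n) : x + x = 0 := by
  funext i; exact CharTwo.add_self_eq_zero (x i)

lemma add_eq_zero_iff_vec {x y : Vec n} : x + y = 0 ↔ x = y := by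
  constructor
  · intro h
    calc x = x + (y + y) := by rw [add_self_vec, add_zero]
      _ = y := by rw [← add_assoc, h, zero_add]
  · rintro rfl; exact add_self_vec x

lemma card_vec : (univ : Finset (Vec n)).card = 2 ^ n := by
  simp [ZMod.card]

lemma sum_sgn_ip (x : Vec n) : ∑ y, sgn (ip x y) = if x = 0 then 2 ^ n else 0 := by
  split_ifs with h
  · subst h; simp [ZMod.card]
  · obtain ⟨i, hi⟩ := Function.ne_iff.mp h
    have hi' : x i = 1 := by
      have : ∀ a : ZMod 2, a ≠ 0 → a = 1 := by decide
      exact this _ hi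
    have h1 : ∀ y, sgn (ip x (y + Pi.single i 1)) = - sgn (ip x y) := by
      intro y
      rw [ip_add_right, sgn_add]
      have : ip x (Pi.single i 1) = 1 := by simp [ip, Pi.single_apply, hi']
      simp [this]
    have h2 := Equiv.sum_comp (Equiv.addRight (Pi.single i 1 : Vec n)) (fun y => sgn (ip x y))
    simp only [Equiv.coe_addRight, h1, sum_neg_distrib] at h2
    omega

/-- The (unnormalised) Fourier transform on 𝔽₂ⁿ. -/
def hat {R : Type*} [CommRing R] (u : Vec n → R) (y : Vec n) : R :=
  ∑ x, u x * (sgn (ip x y) : ℤ)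

lemma walsh_eq_hat (f : Vec n → ZMod 2) (y : Vec n) :
    walsh f y = hat (fun x => sgn (f x)) y := by
  simp only [walsh, hat, Int.cast_id, ← sgn_add]; rfl

section Hat

variable {R : Type*} [CommRing R]

lemma sum_sgn_ip_cast (x : Vec n) :
    ∑ y, ((sgn (ip x y) : ℤ) : R) = if x = 0 then 2 ^ n else 0 := by
  rw [← Int.cast_sum, sum_sgn_ip]; split_ifs <;> simp

lemma sum_sgn_mul_sgn (x x' : Vec n) :
    ∑ y, ((sgn (ip x y) : ℤ) : R) * (sgn (ip x' y) : ℤ) = if x = x' then 2 ^ n else 0 := by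
  have h := sum_sgn_ip_cast (R := R) (x + x')
  simp only [ip_add_left, sgn_add, Int.cast_mul, add_eq_zero_iff_vec] at h
  exact h

lemma hat_hat (u : Vec n → R) (x : Vec n) : hat (hat u) x = 2 ^ n * u x := by
  simp only [hat, sum_mul]
  rw [sum_comm]
  have : ∀ z, ∑ y, u z * ((sgn (ip z y) : ℤ) : R) * (sgn (ip y x) : ℤ)
      = if z = x then 2 ^ n * u x else 0 := by
    intro z
    simp only [ip_comm _ x, mul_assoc, ← mul_sum]
    rw [sum_sgn_mul_sgn]
    split_ifs with h
    · subst h; ring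
    · simp
  simp [this]

lemma sum_hat_mul_hat (u v : Vec n → R) :
    ∑ y, hat u y * hat v y = 2 ^ n * ∑ x, u x * v x := by
  have : ∀ y, hat u y * hat v y = ∑ x, u x * (hat v y * (sgn (ip y x) : ℤ)) := by
    intro y
    rw [hat, sum_mul]
    exact sum_congr rfl fun x _ => by rw [ip_comm x y]; ring
  simp only [this]
  rw [sum_comm]
  simp only [← mul_sum]
  rw [mul_sum]
  refine sum_congr rfl fun x _ => ?_
  rw [show ∑ y, hat v y * ((sgn (ip y x) : ℤ) : R) = 2 ^ n * v x from hat_hat v x]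
  ring

end Hat

lemma hat_injective {u v : Vec n → ℤ} (h : hat u = hat v) : u = v := by
  funext x
  have h1 := hat_hat u x
  rw [h, hat_hat] at h1
  exact (mul_left_cancel₀ (by positivity) h1).symm

lemma hat_cast (u : Vec n → ℤ) (y : Vec n) : ((hat u y : ℤ) : ℝ) = hat (fun x => (u x : ℝ)) y := by
  simp [hat]

/-- The indicator vector of a set of coordinates. -/
def ind (T : Finset (Fin n)) : Vec n := fun i => if i ∈ T then 1 else 0

lemma ip_ind (x : Vec n) (T : Finset (Fin n)) : ip x (ind T) = ∑ i ∈ T, x i := by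
  simp [ip, ind]

lemma sgn_sum (T : Finset (Fin n)) (x : Vec n) : sgn (∑ i ∈ T, x i) = ∏ i ∈ T, sgn (x i) := by
  classical
  induction T using Finset.induction_on with
  | empty => simp
  | insert a s ha ih => rw [sum_insert ha, prod_insert ha, sgn_add, ih]

lemma sum_powerset_sgn (x : Vec n) (J : Finset (Fin n)) :
    ∑ T ∈ J.powerset, sgn (ip x (ind T)) = if ∀ i ∈ J, x i = 0 then 2 ^ J.card else 0 := by
  simp only [ip_ind, sgn_sum]
  rw [← prod_one_add]
  split_ifs with h
  · rw [prod_congr rfl (g := fun _ => (2 : ℤ)) (fun i hi => by rw [h i hi]; rfl)]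
    simp
  · push Not at h
    obtain ⟨i, hi, hx⟩ := h
    refine prod_eq_zero hi ?_
    revert hx; generalize x i = a; revert a; decide

/-- Poisson summation over a coordinate subcube. -/
lemma sum_powerset_hat (u : Vec n → ℤ) (y : Vec n) (J : Finset (Fin n)) :
    ∑ T ∈ J.powerset, hat u (y + ind T)
      = 2 ^ J.card * ∑ x with ∀ i ∈ J, x i = 0, u x * sgn (ip x y) := by
  simp only [hat, Int.cast_id, ip_add_right, sgn_add]
  rw [sum_comm, sum_filter, mul_sum]
  refine sum_congr rfl fun x _ => ?_
  rw [← mul_sum, ← mul_sum, sum_powerset_sgn]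
  split_ifs <;> ring

/-- Sums over coordinate subcubes of dimension `r + 1` vanish. -/
def CubeFree (r : ℕ) (f : Vec n → ZMod 2) : Prop :=
  ∀ x (J : Finset (Fin n)), J.card = r + 1 → ∑ T ∈ J.powerset, f (x + ind T) = 0

/-- The support of a vector. -/
def supp (x : Vec n) : Finset (Fin n) := univ.filter fun i => x i ≠ 0

/-- The Hamming ball of radius `r` around the origin. -/
def ball (n r : ℕ) : Finset (Vec n) := univ.filter fun x => (supp x).card ≤ r

lemma CubeFree.add {r : ℕ} {f g : Vec n → ZMod 2} (hf : CubeFree r f) (hg : CubeFree r g) :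
    CubeFree r (fun x => f x + g x) := by
  intro x J hJ
  rw [sum_add_distrib, hf x J hJ, hg x J hJ, add_zero]

lemma ind_supp (x : Vec n) : ind (supp x) = x := by
  funext i
  simp only [ind, supp, mem_filter, mem_univ, true_and]
  generalize x i = a; revert a; decide

lemma supp_ind (T : Finset (Fin n)) : supp (ind T) = T := by
  ext i; simp [supp, ind]

lemma ind_add_ind {S T : Finset (Fin n)} (h : Disjoint S T) : ind S + ind T = ind (S ∪ T) := by
  funext i
  have : i ∈ S → i ∉ T := fun h1 => Finset.disjoint_left.mp h h1
  simp only [ind, Pi.add_apply, mem_union]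
  by_cases h1 : i ∈ S <;> by_cases h2 : i ∈ T <;> simp_all

lemma CubeFree.eq_zero {r : ℕ} {f : Vec n → ZMod 2} (hf : CubeFree r f)
    (h0 : ∀ x ∈ ball n r, f x = 0) (x : Vec n) : f x = 0 := by
  suffices ∀ m (S : Finset (Fin n)), S.card = m → f (ind S) = 0 by
    rw [← ind_supp x]; exact this _ _ rfl
  intro m
  induction m using Nat.strong_induction_on with
  | _ m ih =>
    intro S hS
    by_cases hm : m ≤ r
    · exact h0 _ (by simp [ball, supp_ind, hS, hm])
    · obtain ⟨J, hJS, hJ⟩ := exists_subset_card_eq (s := S) (n := r + 1) (by omega)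
      have h := hf (ind (S \ J)) J hJ
      have hdis : ∀ T ∈ J.powerset, ind (S \ J) + ind T = ind ((S \ J) ∪ T) := fun T hT =>
        ind_add_ind (disjoint_of_subset_right (mem_powerset.mp hT) sdiff_disjoint)
      rw [sum_congr rfl (fun T hT => by rw [hdis T hT]),
        ← add_sum_erase _ _ (mem_powerset_self J), sum_eq_zero, add_zero,
        sdiff_union_of_subset hJS] at h
      · exact h
      · intro T hT
        obtain ⟨hne, hT⟩ := mem_erase.mp hT
        have hT := mem_powerset.mp hT
        refine ih _ ?_ _ rfl
        rw [← hS]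
        refine card_lt_card ⟨union_subset sdiff_subset (hT.trans hJS), fun hsub => hne ?_⟩
        refine Subset.antisymm hT fun i hi => ?_
        rcases mem_union.mp (hsub (hJS hi)) with h | h
        · exact absurd hi (mem_sdiff.mp h).2
        · exact h

lemma CubeFree.ext {r : ℕ} {f g : Vec n → ZMod 2} (hf : CubeFree r f) (hg : CubeFree r g)
    (h : ∀ x ∈ ball n r, f x = g x) : f = g := by
  funext x
  have := (hf.add hg).eq_zero (fun x hx => by rw [h x hx, CharTwo.add_self_eq_zero]) x
  exact CharTwo.add_eq_zero.mp this

lemma card_ball (n r : ℕ) : (ball n r).card = ballCard n r := by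
  have h1 : (ball n r).card = (univ.filter fun T : Finset (Fin n) => T.card ≤ r).card := by
    refine card_bij' (fun x _ => supp x) (fun T _ => ind T) ?_ ?_ ?_ ?_
    · intro x hx; simpa [ball] using hx
    · intro T hT; simpa [ball, supp_ind] using hT
    · intro x _; exact ind_supp x
    · intro T _; exact supp_ind T
  rw [h1, ballCard]
  have h2 : (univ.filter fun T : Finset (Fin n) => T.card ≤ r)
      = (range (r + 1)).biUnion fun i => powersetCard i univ := by
    ext T; simp [mem_powersetCard]
  rw [h2, card_biUnion]
  · simp
  · intro i _ j _ hij
    exact pairwise_disjoint_powersetCard _ hij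

lemma two_pow_le_two_mul_ballCard {d k : ℕ} (h : d + 3 = 2 * k) : 2 ^ d ≤ 2 * ballCard d k := by
  obtain ⟨m, rfl⟩ : ∃ m, k = m + 2 := ⟨k - 2, by omega⟩
  obtain rfl : d = 2 * m + 1 := by omega
  have h1 := Nat.sum_range_choose_halfway m
  have h2 : ∑ i ∈ range (m + 1), (2 * m + 1).choose i ≤ ballCard (2 * m + 1) (m + 2) :=
    sum_le_sum_of_subset (range_subset_range.mpr (by omega))
  have h3 : 2 ^ (2 * m + 1) = 2 * 4 ^ m := by rw [pow_succ, pow_mul]; norm_num; ring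
  omega

/-- The space 𝔽₂ᵈ × 𝔽₂². -/
abbrev Split (d : ℕ) := Vec d × ZMod 2 × ZMod 2

variable {d k : ℕ}

/-- Inner product on `Split d`. -/
def ipS (x y : Split d) : ZMod 2 := ip x.1 y.1 + x.2.1 * y.2.1 + x.2.2 * y.2.2

/-- Walsh–Hadamard transform on `Split d`. -/
def walshS (G : Split d → ZMod 2) (y : Split d) : ℤ := ∑ x, sgn (G x + ipS x y)

/-- The normalised Walsh spectrum of a plateaued function on `Split d`. -/
noncomputable def specS (G : Split d → ZMod 2) (y : Split d) : SignType :=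
  SignType.sign (walshS G y)

/-- All Walsh coefficients of `G` are `0` or `± 2ᵏ`. -/
def PlatS (k : ℕ) (G : Split d → ZMod 2) : Prop := ∀ y, walshS G y = 2 ^ k * (specS G y : ℤ)

/-- The transform of the restriction of `G` to a coset of 𝔽₂ᵈ. -/
def sliceHat (G : Split d → ZMod 2) (i j : ZMod 2) : Vec d → ℤ := hat fun x => sgn (G (x, i, j))

lemma walshS_eq (G : Split d → ZMod 2) (y : Vec d) (p q : ZMod 2) :
    walshS G (y, p, q) = ∑ i, ∑ j, sgn (i * p) * sgn (j * q) * sliceHat G i j y := by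
  simp only [walshS, sliceHat, hat, Fintype.sum_prod_type, ipS, sgn_add, Int.cast_id, mul_sum]
  rw [sum_comm]
  refine sum_congr rfl fun i _ => ?_
  rw [sum_comm]
  refine sum_congr rfl fun j _ => sum_congr rfl fun x _ => ?_
  ring

lemma four_mul_sliceHat (G : Split d → ZMod 2) (i j : ZMod 2) (y : Vec d) :
    4 * sliceHat G i j y = ∑ p, ∑ q, sgn (i * p) * sgn (j * q) * walshS G (y, p, q) := by
  simp only [walshS_eq, sum_zmod_two, mul_zero, zero_mul, sgn_zero, mul_one, sgn_one, one_mul]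
  revert i j
  simp only [forall_zmod_two, sgn_zero, sgn_one]
  refine ⟨⟨?_, ?_⟩, ?_, ?_⟩ <;> ring

lemma PlatS.cubeFree_slice {G : Split d → ZMod 2} (hG : PlatS k G) (hd : d + 3 = 2 * k)
    (i j : ZMod 2) : CubeFree k fun x => G (x, i, j) := by
  obtain ⟨m, rfl⟩ : ∃ m, k = m + 2 := ⟨k - 2, by omega⟩
  have hH : ∀ y, ∃ z : ℤ, sliceHat G i j y = 2 ^ m * z := fun y => by
    refine ⟨∑ p, ∑ q, sgn (i * p) * sgn (j * q) * (specS G (y, p, q) : ℤ), ?_⟩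
    have h := four_mul_sliceHat G i j y
    simp only [hG _] at h
    have h4 : (4 : ℤ) ≠ 0 := by norm_num
    apply mul_left_cancel₀ h4
    rw [h, mul_sum, mul_sum]
    refine sum_congr rfl fun p _ => ?_
    rw [mul_sum, mul_sum]
    refine sum_congr rfl fun q _ => ?_
    ring
  choose z hz using hH
  intro x J hJ
  have h := sum_powerset_hat (sliceHat G i j) x J
  simp only [sliceHat, hat_hat] at h
  rw [← mul_sum, hJ] at h
  change _ = _ * ∑ y with _, sliceHat G i j y * _ at h
  simp only [hz, mul_assoc] at h
  rw [← mul_sum] at h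
  set Z := ∑ y with ∀ i ∈ J, y i = 0, z y * sgn (ip y x) with hZ
  have h1 : ∑ T ∈ J.powerset, sgn (G (x + ind T, i, j)) = 4 * Z := by
    apply mul_left_cancel₀ (show (2 : ℤ) ^ d ≠ 0 by positivity)
    rw [h, ← mul_assoc, ← mul_assoc, ← pow_add, show (4 : ℤ) = 2 ^ 2 by norm_num, ← pow_add]
    congr 2; omega
  simp only [sgn_eq, sum_sub_distrib, ← mul_sum, sum_const, card_powerset, hJ] at h1
  have h2 : (2 : ℤ) ∣ ∑ T ∈ J.powerset, ((G (x + ind T, i, j)).val : ℤ) := by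
    rw [pow_succ, pow_succ] at h1
    simp only [nsmul_eq_mul, mul_one, Nat.cast_mul, Nat.cast_pow, Nat.cast_ofNat] at h1
    rw [pow_succ] at h1
    omega
  have h3 := (ZMod.intCast_zmod_eq_zero_iff_dvd _ 2).mpr h2
  simpa using h3

/-- The indicator of the Walsh support on 𝔽₂ᵈ, as a Boolean function. -/
noncomputable def suppS (G : Split d → ZMod 2) (y : Vec d) : ZMod 2 :=
  ((specS G (y, 0, 0) : ℤ) : ZMod 2)

lemma PlatS.cubeFree_suppS {G : Split d → ZMod 2} (hG : PlatS k G) :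
    CubeFree k (suppS G) := by
  intro y J hJ
  have hW : ∀ y, walshS G (y, 0, 0) = hat (fun x => ∑ i, ∑ j, sgn (G (x, i, j))) y := by
    intro y
    simp only [walshS_eq, sliceHat, hat, sum_zmod_two, mul_zero, sgn_zero, one_mul, Int.cast_id,
      ← sum_add_distrib, add_mul]
  have h := sum_powerset_hat (fun x => ∑ i, ∑ j, sgn (G (x, i, j))) y J
  simp only [← hW, hG _, ← mul_sum, hJ] at h
  have he : ∀ x, ∃ r, ∑ i, ∑ j, sgn (G (x, i, j)) = 2 * r := fun x =>
    ⟨2 - ∑ i, ∑ j, ((G (x, i, j)).val : ℤ), by simp only [sgn_eq, sum_zmod_two]; ring⟩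
  choose r hr using he
  simp only [hr, mul_assoc, ← mul_sum] at h
  rw [pow_succ, mul_assoc] at h
  have h1 := mul_left_cancel₀ (by positivity) h
  have h2 : (2 : ℤ) ∣ ∑ T ∈ J.powerset, (specS G (y + ind T, 0, 0) : ℤ) := ⟨_, h1⟩
  have h3 := (ZMod.intCast_zmod_eq_zero_iff_dvd _ 2).mpr h2
  simpa [suppS] using h3

/-- `G` and `G'` agree on the three nontrivial cosets of 𝔽₂ᵈ. -/
def AgreeOff (G G' : Split d → ZMod 2) : Prop :=
  ∀ x, G (x, 0, 1) = G' (x, 0, 1) ∧ G (x, 1, 0) = G' (x, 1, 0) ∧ G (x, 1, 1) = G' (x, 1, 1)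

lemma AgreeOff.spec_sub {G G' : Split d → ZMod 2} (h : AgreeOff G G') (hG : PlatS k G)
    (hG' : PlatS k G') (y : Vec d) (p q : ZMod 2) :
    (specS G (y, p, q) : ℤ) - specS G' (y, p, q)
      = specS G (y, 0, 0) - specS G' (y, 0, 0) := by
  have key : ∀ p q, (2 : ℤ) ^ k * ((specS G (y, p, q) : ℤ) - specS G' (y, p, q))
      = sliceHat G 0 0 y - sliceHat G' 0 0 y := by
    intro p q
    rw [mul_sub, ← hG, ← hG', walshS_eq, walshS_eq]
    simp only [sum_zmod_two, zero_mul, sgn_zero, one_mul, sliceHat, (h _).1, (h _).2.1, (h _).2.2]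
    ring
  exact mul_left_cancel₀ (show (2 : ℤ) ^ k ≠ 0 by positivity) ((key p q).trans (key 0 0).symm)

lemma AgreeOff.eq {G G' : Split d → ZMod 2} (h : AgreeOff G G') (hG : PlatS k G)
    (hG' : PlatS k G') (hs : ∀ y, specS G (y, 0, 0) = specS G' (y, 0, 0)) : G = G' := by
  have h0 : sliceHat G 0 0 = sliceHat G' 0 0 := by
    funext y
    have h1 : walshS G (y, 0, 0) = walshS G' (y, 0, 0) := by rw [hG, hG', hs]
    simp only [walshS_eq, sum_zmod_two, mul_zero, sgn_zero, one_mul] at h1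
    simp only [sliceHat, (h _).1, (h _).2.1, (h _).2.2] at h1 ⊢
    linarith
  have h1 := hat_injective h0
  have h2 : ∀ x i j, G (x, i, j) = G' (x, i, j) := by
    intro x
    simp only [forall_zmod_two]
    exact ⟨⟨sgn_injective (congrFun h1 x), (h x).1⟩, (h x).2⟩
  funext ⟨x, i, j⟩
  exact h2 x i j

/-- The type of a quadruple of signs: the number of nonzero entries if the nonzero entries all
agree, and `5` otherwise. -/
def quadType (a b c e : SignType) : Fin 6 :=
  if (a ≠ -1 ∧ b ≠ -1 ∧ c ≠ -1 ∧ e ≠ -1) ∨ (a ≠ 1 ∧ b ≠ 1 ∧ c ≠ 1 ∧ e ≠ 1) then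
    (if a = 0 then 0 else 1) + (if b = 0 then 0 else 1) + (if c = 0 then 0 else 1)
      + (if e = 0 then 0 else 1)
  else 5

/-- The type of the Walsh spectrum over `y`. -/
noncomputable def typeS (G : Split d → ZMod 2) (y : Vec d) : Fin 6 :=
  quadType (specS G (y, 0, 0)) (specS G (y, 1, 0)) (specS G (y, 0, 1)) (specS G (y, 1, 1))

set_option maxRecDepth 100000 in
set_option synthInstance.maxSize 4000 in
set_option synthInstance.maxHeartbeats 400000 in
lemma quadType_compat : ∀ a a' b b' : SignType, (b : ℤ) - b' = a - a' →
    ∀ c c' : SignType, (c : ℤ) - c' = a - a' → ∀ e e' : SignType, (e : ℤ) - e' = a - a' →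
    (((a : ℤ) : ZMod 2) = ((a' : ℤ) : ZMod 2) → quadType a b c e = quadType a' b' c' e' ∧
      (quadType a b c e ≠ 4 → a = a')) ∧
    (((a : ℤ) : ZMod 2) ≠ ((a' : ℤ) : ZMod 2) → quadType a b c e ≠ 5 ∧
      quadType a b c e + quadType a' b' c' e' = 4) := by
  decide

lemma typeS_compat {G G' : Split d → ZMod 2} (h : AgreeOff G G') (hG : PlatS k G)
    (hG' : PlatS k G') (y : Vec d) :
    (suppS G y = suppS G' y → typeS G y = typeS G' y ∧
      (typeS G y ≠ 4 → specS G (y, 0, 0) = specS G' (y, 0, 0))) ∧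
    (suppS G y ≠ suppS G' y → typeS G y ≠ 5 ∧ typeS G y + typeS G' y = 4) :=
  quadType_compat _ _ _ _ (h.spec_sub hG hG' y 1 0) _ _ (h.spec_sub hG hG' y 0 1) _ _
    (h.spec_sub hG hG' y 1 1)

/-- Kraft inequality, one stage: the bits `b G y`, `y ∈ A`, are encoded with weights `w G y`. -/
lemma sum_prod_mul_le_one {Γ Y : Type*} (A : Finset Y)
    (b : Γ → Y → ZMod 2) (w : Γ → Y → ℝ) (v : Γ → ℝ) (s : Finset Γ)
    (hw0 : ∀ G y, 0 ≤ w G y) (hw1 : ∀ G y, w G y ≤ 1)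
    (heq : ∀ G ∈ s, ∀ G' ∈ s, ∀ y ∈ A, b G y = b G' y → w G y = w G' y)
    (hne : ∀ G ∈ s, ∀ G' ∈ s, ∀ y ∈ A, b G y ≠ b G' y → w G y + w G' y ≤ 1)
    (hv : ∀ t ⊆ s, (∀ G ∈ t, ∀ G' ∈ t, ∀ y ∈ A, b G y = b G' y) → ∑ G ∈ t, v G ≤ 1) :
    ∑ G ∈ s, (∏ y ∈ A, w G y) * v G ≤ 1 := by
  classical
  induction A using Finset.induction_on generalizing s with
  | empty => simpa using hv s Subset.rfl
  | insert a A ha ih =>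
    have hfib : ∀ G₀ ∈ s, ∑ G ∈ s with b G a = b G₀ a, (∏ y ∈ insert a A, w G y) * v G
        ≤ w G₀ a := by
      intro G₀ h₀
      have h1 : ∑ G ∈ s with b G a = b G₀ a, (∏ y ∈ insert a A, w G y) * v G
          = w G₀ a * ∑ G ∈ s with b G a = b G₀ a, (∏ y ∈ A, w G y) * v G := by
        rw [mul_sum]
        refine sum_congr rfl fun G hG => ?_
        obtain ⟨hG, hb⟩ := mem_filter.mp hG
        rw [prod_insert ha, heq G hG G₀ h₀ a (mem_insert_self _ _) hb]
        ring
      rw [h1]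
      refine mul_le_of_le_one_right (hw0 _ _) (ih _ ?_ ?_ ?_)
      · intro G hG G' hG' y hy
        exact heq G (mem_filter.mp hG).1 G' (mem_filter.mp hG').1 y (mem_insert_of_mem hy)
      · intro G hG G' hG' y hy
        exact hne G (mem_filter.mp hG).1 G' (mem_filter.mp hG').1 y (mem_insert_of_mem hy)
      · intro t ht hb
        refine hv t (ht.trans (filter_subset _ _)) fun G hG G' hG' y hy => ?_
        rcases mem_insert.mp hy with rfl | hy
        · rw [(mem_filter.mp (ht hG)).2, (mem_filter.mp (ht hG')).2]
        · exact hb G hG G' hG' y hy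
    rcases s.eq_empty_or_nonempty with rfl | ⟨G₀, h₀⟩
    · simp
    · rw [← sum_filter_add_sum_filter_not s (fun G => b G a = b G₀ a)]
      by_cases hex : ∃ G₁ ∈ s, b G₁ a ≠ b G₀ a
      · obtain ⟨G₁, h₁, hb⟩ := hex
        have h2 : s.filter (fun G => ¬ b G a = b G₀ a) = s.filter (fun G => b G a = b G₁ a) := by
          refine filter_congr fun G _ => ?_
          generalize b G a = p at *
          generalize b G₀ a = q at *
          generalize b G₁ a = r at *
          revert p q r; decide
        rw [h2]
        have h3 := hne G₀ h₀ G₁ h₁ a (mem_insert_self _ _) (Ne.symm hb)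
        linarith [hfib G₀ h₀, hfib G₁ h₁]
      · push Not at hex
        rw [filter_false_of_mem (s := s) (p := fun G => ¬ b G a = b G₀ a)
          (fun G hG => not_not.mpr (hex G hG)), sum_empty, add_zero]
        exact (hfib G₀ h₀).trans (hw1 _ _)

lemma sum_one_le_one {Γ : Type*} {s : Finset Γ} (h : ∀ G ∈ s, ∀ G' ∈ s, G = G') :
    ∑ _G ∈ s, (1 : ℝ) ≤ 1 := by
  simp only [sum_const, nsmul_eq_mul, mul_one]
  exact_mod_cast card_le_one.mpr h

/-- The weight used to encode the support bit, by type of the quadruple. -/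
noncomputable def wt : Fin 6 → ℝ := ![8 / 9, 4 / 5, 1 / 2, 1 / 5, 1 / 9, 1]

lemma wt_pos (t : Fin 6) : 0 < wt t := by fin_cases t <;> norm_num [wt]

lemma wt_le_one (t : Fin 6) : wt t ≤ 1 := by fin_cases t <;> norm_num [wt]

lemma wt_add_le_one (t t' : Fin 6) (h : t ≠ 5) (h' : t + t' = 4) : wt t + wt t' ≤ 1 := by
  revert h h'
  fin_cases t <;> fin_cases t' <;> first | (intro h h'; exfalso; revert h h'; decide) | skip
  all_goals norm_num [wt]

/-- The three nontrivial cosets of 𝔽₂ᵈ. -/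
def offCosets : Finset (ZMod 2 × ZMod 2) := {(0, 1), (1, 0), (1, 1)}

lemma mem_offCosets_iff {p : ZMod 2 × ZMod 2} : p ∈ offCosets ↔ p ≠ (0, 0) := by
  revert p; decide

lemma agreeOff_of_ball (hd : d + 3 = 2 * k) {G G' : Split d → ZMod 2} (hG : PlatS k G)
    (hG' : PlatS k G') (h : ∀ y ∈ ball d k ×ˢ offCosets, G y = G' y) : AgreeOff G G' := by
  have key : ∀ i j, (i, j) ≠ ((0, 0) : ZMod 2 × ZMod 2) → ∀ x, G (x, i, j) = G' (x, i, j) :=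
    fun i j hij x => congrFun ((hG.cubeFree_slice hd i j).ext (hG'.cubeFree_slice hd i j)
      fun x hx => h (x, i, j) (mem_product.mpr ⟨hx, mem_offCosets_iff.mpr hij⟩)) x
  exact fun x => ⟨key _ _ (by decide) x, key _ _ (by decide) x, key _ _ (by decide) x⟩

/-- Kraft inequality for plateaued functions encoded by three cosets, the support and signs. -/
lemma kraft_quad (hd : d + 3 = 2 * k) (s : Finset (Split d → ZMod 2))
    (hs : ∀ G ∈ s, PlatS k G) :
    ∑ G ∈ s, (1 / 2 : ℝ) ^ (3 * (ball d k).card) * ((∏ y ∈ ball d k, wt (typeS G y)) *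
      ∏ y, (if typeS G y = 4 then 1 / 2 else 1)) ≤ 1 := by
  classical
  have hcard : (ball d k ×ˢ offCosets).card = 3 * (ball d k).card := by
    rw [card_product, mul_comm]; rfl
  have h := sum_prod_mul_le_one (ball d k ×ˢ offCosets) (fun (G : Split d → ZMod 2) y => G y)
    (fun _ _ => (1 / 2 : ℝ)) (fun G => (∏ y ∈ ball d k, wt (typeS G y)) *
      ∏ y, (if typeS G y = 4 then 1 / 2 else 1)) s (by intros; norm_num) (by intros; norm_num)
    (by intros; rfl) (by intros; norm_num) ?_
  · simpa only [prod_const, hcard] using h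
  intro t ht hb₁
  have hagree : ∀ G ∈ t, ∀ G' ∈ t, AgreeOff G G' := fun G hG G' hG' =>
    agreeOff_of_ball hd (hs G (ht hG)) (hs G' (ht hG')) (hb₁ G hG G' hG')
  refine sum_prod_mul_le_one (ball d k) suppS _ _ _ (fun _ _ => (wt_pos _).le)
    (fun _ _ => wt_le_one _) ?_ ?_ ?_
  · intro G hG G' hG' y _ hb
    rw [((typeS_compat (hagree G hG G' hG') (hs G (ht hG)) (hs G' (ht hG')) y).1 hb).1]
  · intro G hG G' hG' y _ hb
    obtain ⟨h5, h4⟩ := (typeS_compat (hagree G hG G' hG') (hs G (ht hG)) (hs G' (ht hG')) y).2 hb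
    exact wt_add_le_one _ _ h5 h4
  intro t' ht' hb₂
  have key : ∀ G ∈ t', ∀ G' ∈ t',
      PlatS k G ∧ PlatS k G' ∧ AgreeOff G G' ∧ ∀ y, typeS G y = typeS G' y ∧
      (typeS G y ≠ 4 → specS G (y, 0, 0) = specS G' (y, 0, 0)) := by
    intro G hG G' hG'
    have hp := hs G (ht (ht' hG))
    have hp' := hs G' (ht (ht' hG'))
    have ha := hagree G (ht' hG) G' (ht' hG')
    have hS := hp.cubeFree_suppS.ext hp'.cubeFree_suppS (hb₂ G hG G' hG')
    exact ⟨hp, hp', ha, fun y => (typeS_compat ha hp hp' y).1 (congrFun hS y)⟩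
  have h := sum_prod_mul_le_one univ
    (fun (G : Split d → ZMod 2) y => if specS G (y, 0, 0) = 1 then (1 : ZMod 2) else 0)
    (fun G y => if typeS G y = 4 then (1 / 2 : ℝ) else 1) (fun _ => 1) t'
    (fun _ _ => by split_ifs <;> norm_num) (fun _ _ => by split_ifs <;> norm_num) ?_ ?_ ?_
  · simpa only [mul_one] using h
  · intro G hG G' hG' y _ _
    rw [((key G hG G' hG').2.2.2 y).1]
  · intro G hG G' hG' y _ hb
    obtain ⟨h1, h2⟩ := (key G hG G' hG').2.2.2 y
    by_cases h4 : typeS G y = 4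
    · rw [← h1, if_pos h4]; norm_num
    · exact absurd (by rw [h2 h4]) hb
  · intro t'' ht'' hb
    refine sum_one_le_one fun G hG G' hG' => ?_
    obtain ⟨hp, hp', ha, hty⟩ := key G (ht'' hG) G' (ht'' hG')
    refine ha.eq hp hp' fun y => ?_
    obtain ⟨h1, h2⟩ := hty y
    by_cases h4 : typeS G y = 4
    · have h3 := hb G hG G' hG' y (mem_univ y)
      have aux : ∀ a b c e, quadType a b c e = 4 → a ≠ 0 := by decide
      have n1 := aux _ _ _ _ h4
      have n2 := aux _ _ _ _ (h1.symm.trans h4)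
      revert h3 n1 n2
      generalize specS G (y, 0, 0) = p
      generalize specS G' (y, 0, 0) = q
      revert p q; decide
    · exact h2 h4

/-- Kraft inequality for plateaued functions with a biased derivative. -/
lemma kraft_pair (hd : d + 3 = 2 * k) (c : ZMod 2) (s : Finset (Split d → ZMod 2))
    (hs : ∀ G ∈ s, PlatS k G) :
    ∑ G ∈ s, (1 / 2 : ℝ) ^ (2 * (ball d k).card) * ∏ y ∈ ball d k ×ˢ univ,
      (if G (y.1, 1, y.2) = G (y.1, 0, y.2) + c then 4 / 5 else 1 / 5) ≤ 1 := by
  classical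
  have hcard : (ball d k ×ˢ (univ : Finset (ZMod 2))).card = 2 * (ball d k).card := by
    rw [card_product, mul_comm]; rfl
  have h := sum_prod_mul_le_one (ball d k ×ˢ (univ : Finset (ZMod 2)))
    (fun (G : Split d → ZMod 2) y => G (y.1, 0, y.2))
    (fun _ _ => (1 / 2 : ℝ)) (fun G => ∏ y ∈ ball d k ×ˢ univ,
      (if G (y.1, 1, y.2) = G (y.1, 0, y.2) + c then 4 / 5 else 1 / 5)) s
    (by intros; norm_num) (by intros; norm_num)
    (by intros; rfl) (by intros; norm_num) ?_
  · simpa only [prod_const, hcard] using h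
  intro t ht hb₁
  have h := sum_prod_mul_le_one (ball d k ×ˢ (univ : Finset (ZMod 2)))
    (fun (G : Split d → ZMod 2) y => G (y.1, 1, y.2))
    (fun G y => if G (y.1, 1, y.2) = G (y.1, 0, y.2) + c then (4 / 5 : ℝ) else 1 / 5)
    (fun _ => 1) t
    (fun _ _ => by split_ifs <;> norm_num) (fun _ _ => by split_ifs <;> norm_num) ?_ ?_ ?_
  · simpa only [mul_one] using h
  · intro G hG G' hG' y hy hb
    have h1 := hb₁ G hG G' hG' y hy
    simp only [hb, h1]
  · intro G hG G' hG' y hy hb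
    have h1 := hb₁ G hG G' hG' y hy
    rw [h1]
    by_cases h2 : G (y.1, 1, y.2) = G' (y.1, 0, y.2) + c
    · rw [if_pos h2, if_neg (fun h3 => hb (h2.trans h3.symm))]; norm_num
    · rw [if_neg h2]; split_ifs <;> norm_num
  · intro t' ht' hb₂
    refine sum_one_le_one fun G hG G' hG' => ?_
    have hp := hs G (ht (ht' hG))
    have hp' := hs G' (ht (ht' hG'))
    have key : ∀ i j x, G (x, i, j) = G' (x, i, j) := by
      intro i j x
      refine congrFun ((hp.cubeFree_slice hd i j).ext (hp'.cubeFree_slice hd i j)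
        fun x hx => ?_) x
      have hm : (x, j) ∈ ball d k ×ˢ (univ : Finset (ZMod 2)) := mem_product.mpr ⟨hx, mem_univ _⟩
      revert i
      rw [forall_zmod_two]
      exact ⟨hb₁ G (ht' hG) G' (ht' hG') _ hm, hb₂ G hG G' hG' _ hm⟩
    funext ⟨x, i, j⟩
    exact key i j x

lemma card_le_two_rpow {Γ : Type*} {s : Finset Γ} {Q : Γ → ℝ} {B : ℝ} (hQ : ∑ G ∈ s, Q G ≤ 1)
    (hB : ∀ G ∈ s, (2 : ℝ) ^ (-B) ≤ Q G) : (s.card : ℝ) ≤ 2 ^ B := by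
  have h1 : (s.card : ℝ) * 2 ^ (-B) ≤ 1 := by
    calc (s.card : ℝ) * 2 ^ (-B) = ∑ _G ∈ s, (2 : ℝ) ^ (-B) := by simp
      _ ≤ _ := (sum_le_sum hB).trans hQ
  rw [Real.rpow_neg (by norm_num)] at h1
  have h2 : (0 : ℝ) < 2 ^ B := by positivity
  calc (s.card : ℝ) = s.card * (2 ^ B)⁻¹ * 2 ^ B := by field_simp
    _ ≤ 1 * 2 ^ B := by gcongr
    _ = 2 ^ B := one_mul _

/-- The number of bits used for the support bit, by type of the quadruple. -/
noncomputable def cost (t : Fin 6) : ℝ := -Real.logb 2 (wt t)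

lemma cost_nonneg (t : Fin 6) : 0 ≤ cost t :=
  neg_nonneg.mpr (Real.logb_nonpos (by norm_num) (wt_pos t).le (wt_le_one t))

lemma two_rpow_neg_cost (t : Fin 6) : (2 : ℝ) ^ (-cost t) = wt t := by
  rw [cost, neg_neg, Real.rpow_logb (by norm_num) (by norm_num) (wt_pos t)]

lemma card_quad_le (hd : d + 3 = 2 * k) (B : ℝ) (s : Finset (Split d → ZMod 2))
    (hs : ∀ G ∈ s, PlatS k G ∧ ∑ y ∈ ball d k, cost (typeS G y)
      + ∑ y, (if typeS G y = 4 then (1 : ℝ) else 0) ≤ B) :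
    (s.card : ℝ) ≤ 2 ^ (3 * (ball d k).card + B) := by
  refine card_le_two_rpow (kraft_quad hd s fun G hG => (hs G hG).1) fun G hG => ?_
  have h1 : ∏ y ∈ ball d k, wt (typeS G y) = (2 : ℝ) ^ (-∑ y ∈ ball d k, cost (typeS G y)) := by
    rw [← sum_neg_distrib, Real.rpow_sum_of_pos (by norm_num)]
    simp only [two_rpow_neg_cost]
  have h2 : (∏ y, (if typeS G y = 4 then 1 / 2 else 1) : ℝ)
      = (2 : ℝ) ^ (-∑ y, (if typeS G y = 4 then (1 : ℝ) else 0)) := by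
    rw [← sum_neg_distrib, Real.rpow_sum_of_pos (by norm_num)]
    refine prod_congr rfl fun y _ => ?_
    split_ifs
    · rw [Real.rpow_neg_one]; norm_num
    · simp
  have h3 : (1 / 2 : ℝ) ^ (3 * (ball d k).card) = 2 ^ (-(3 * (ball d k).card : ℝ)) := by
    rw [Real.rpow_neg (by norm_num), one_div, inv_pow, ← Real.rpow_natCast]; push_cast; rfl
  rw [h1, h2, h3, ← Real.rpow_add (by norm_num), ← Real.rpow_add (by norm_num)]
  refine Real.rpow_le_rpow_of_exponent_le (by norm_num) ?_
  linarith [(hs G hG).2]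

lemma card_pair_le (hd : d + 3 = 2 * k) (c : ZMod 2) (s : Finset (Split d → ZMod 2))
    (hs : ∀ G ∈ s, PlatS k G ∧ ∑ y ∈ ball d k ×ˢ univ,
      (if G (y.1, 1, y.2) = G (y.1, 0, y.2) + c then (0 : ℝ) else 1) ≤ 2 / 5 * (ball d k).card) :
    (s.card : ℝ) ≤ 2 ^ ((2 * Real.logb 2 5 - 6 / 5) * (ball d k).card) := by
  refine card_le_two_rpow (kraft_pair hd c s fun G hG => (hs G hG).1) fun G hG => ?_
  have h2 : (∏ y ∈ ball d k ×ˢ univ,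
      (if G (y.1, 1, y.2) = G (y.1, 0, y.2) + c then 4 / 5 else 1 / 5) : ℝ)
      = (2 : ℝ) ^ (∑ y ∈ ball d k ×ˢ univ, (2 - Real.logb 2 5 -
        2 * (if G (y.1, 1, y.2) = G (y.1, 0, y.2) + c then (0 : ℝ) else 1))) := by
    rw [Real.rpow_sum_of_pos (by norm_num)]
    refine prod_congr rfl fun y _ => ?_
    split_ifs
    · rw [mul_zero, sub_zero, Real.rpow_sub (by norm_num),
        Real.rpow_logb (by norm_num) (by norm_num) (by norm_num)]; norm_num
    · rw [show 2 - Real.logb 2 5 - 2 * 1 = - Real.logb 2 5 by ring, Real.rpow_neg (by norm_num),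
        Real.rpow_logb (by norm_num) (by norm_num) (by norm_num)]; norm_num
  have h3 : (1 / 2 : ℝ) ^ (2 * (ball d k).card) = 2 ^ (-(2 * (ball d k).card : ℝ)) := by
    rw [Real.rpow_neg (by norm_num), one_div, inv_pow, ← Real.rpow_natCast]; push_cast; rfl
  rw [h2, h3, ← Real.rpow_add (by norm_num), sum_sub_distrib, ← mul_sum, sum_const, card_product,
    card_univ, ZMod.card]
  refine Real.rpow_le_rpow_of_exponent_le (by norm_num) ?_
  have := (hs G hG).2
  push_cast [nsmul_eq_mul]
  linarith

/-- The cross-correlation of two functions on 𝔽₂ⁿ. -/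
def corr {R : Type*} [CommRing R] (u v : Vec n → R) (a : Vec n) : R := ∑ y, u y * v (y + a)

lemma sum_add_left_vec {M : Type*} [AddCommMonoid M] (a : Vec n) (f : Vec n → M) :
    ∑ y, f (a + y) = ∑ y, f y :=
  Equiv.sum_comp (Equiv.addLeft a) f

lemma sum_add_right_vec {M : Type*} [AddCommMonoid M] (a : Vec n) (f : Vec n → M) :
    ∑ y, f (y + a) = ∑ y, f y :=
  Equiv.sum_comp (Equiv.addRight a) f

lemma hat_corr {R : Type*} [CommRing R] (u v : Vec n → R) (x : Vec n) :
    hat (corr u v) x = hat u x * hat v x := by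
  simp only [hat, corr, sum_mul]
  rw [sum_comm]
  refine sum_congr rfl fun y _ => ?_
  rw [mul_sum, ← sum_add_left_vec y fun z => u y * ((sgn (ip y x) : ℤ) : R) *
    (v z * ((sgn (ip z x) : ℤ) : R))]
  refine sum_congr rfl fun a _ => ?_
  have h : ((sgn (ip y x) : ℤ) : R) * (sgn (ip y x) : ℤ) = 1 := by
    rw [← Int.cast_mul, sgn_mul_self, Int.cast_one]
  rw [ip_add_left, sgn_add, Int.cast_mul]
  linear_combination (-(u y * v (y + a) * ((sgn (ip a x) : ℤ) : R))) * h

lemma sum_hat_four {R : Type*} [CommRing R] (u₁ u₂ u₃ u₄ : Vec n → R) :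
    ∑ x, hat u₁ x * hat u₂ x * (hat u₃ x * hat u₄ x)
      = 2 ^ n * ∑ a, ∑ b, ∑ y, u₁ y * u₂ (y + a) * (u₃ (y + b) * u₄ (y + b + a)) := by
  simp_rw [← hat_corr u₁ u₂, ← hat_corr u₃ u₄]
  rw [sum_hat_mul_hat]
  congr 1
  refine sum_congr rfl fun a _ => ?_
  rw [sum_comm, corr, sum_mul]
  refine sum_congr rfl fun y _ => ?_
  rw [corr, mul_sum, ← sum_add_left_vec y]

/-- The normalised Walsh spectrum of a plateaued function. -/
noncomputable def spec (g : Vec n → ZMod 2) (y : Vec n) : SignType := SignType.sign (walsh g y)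

/-- All Walsh coefficients of `g` are `0` or `± 2ᵏ`. -/
def Plat (k : ℕ) (g : Vec n → ZMod 2) : Prop := ∀ y, walsh g y = 2 ^ k * (spec g y : ℤ)

/-- The type of the quadruple of spectrum values on the flat `y + ⟨a, b⟩`. -/
noncomputable def quad (g : Vec n → ZMod 2) (a b y : Vec n) : Fin 6 :=
  quadType (spec g y) (spec g (y + a)) (spec g (y + b)) (spec g (y + b + a))

/-- The autocorrelation of a Boolean function. -/
def autoCorr (g : Vec n → ZMod 2) (a : Vec n) : ℝ := ∑ y, (sgn (g y) : ℝ) * sgn (g (y + a))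

/-- The Fourier transform of the indicator of a level set of the spectrum. -/
noncomputable def levelHat (g : Vec n → ZMod 2) (s : SignType) : Vec n → ℝ :=
  hat fun y => if spec g y = s then 1 else 0

lemma sum_quad (g : Vec n → ZMod 2) (φ : Fin 6 → ℝ) :
    2 ^ n * ∑ a, ∑ b, ∑ y, φ (quad g a b y)
      = ∑ x, ∑ s₁, ∑ s₂, ∑ s₃, ∑ s₄, φ (quadType s₁ s₂ s₃ s₄) *
        (levelHat g s₁ x * levelHat g s₂ x * (levelHat g s₃ x * levelHat g s₄ x)) := by
  let ι : SignType → Vec n → ℝ := fun s y => if spec g y = s then 1 else 0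
  have h1 : ∀ a b y, φ (quad g a b y) = ∑ t : SignType × SignType × SignType × SignType,
      φ (quadType t.1 t.2.1 t.2.2.1 t.2.2.2) *
      (ι t.1 y * ι t.2.1 (y + a) * (ι t.2.2.1 (y + b) * ι t.2.2.2 (y + b + a))) := by
    intro a b y
    simp [quad, ι, Fintype.sum_prod_type]
  have hswap : ∀ F : Vec n → Vec n → Vec n → SignType × SignType × SignType × SignType → ℝ,
      ∑ a, ∑ b, ∑ y, ∑ t, F a b y t = ∑ t, ∑ a, ∑ b, ∑ y, F a b y t := fun F =>
    (sum_congr rfl fun a _ => (sum_congr rfl fun b _ => sum_comm).trans sum_comm).trans sum_comm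
  simp only [h1]
  rw [hswap]
  simp only [← mul_sum]
  rw [mul_sum]
  trans ∑ t : SignType × SignType × SignType × SignType,
      ∑ x, φ (quadType t.1 t.2.1 t.2.2.1 t.2.2.2) * (levelHat g t.1 x * levelHat g t.2.1 x *
      (levelHat g t.2.2.1 x * levelHat g t.2.2.2 x))
  · refine sum_congr rfl fun t _ => ?_
    rw [← mul_sum, mul_left_comm, ← sum_hat_four]
    rfl
  · rw [sum_comm]
    simp only [Fintype.sum_prod_type]

lemma univ_signType : (univ : Finset SignType) = {0, -1, 1} := by decide

set_option maxHeartbeats 1000000 in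
lemma sum_signType_quad (φ : Fin 6 → ℝ) (p : SignType → ℝ) :
    ∑ s₁, ∑ s₂, ∑ s₃, ∑ s₄, φ (quadType s₁ s₂ s₃ s₄) * (p s₁ * p s₂ * (p s₃ * p s₄))
      = φ 0 * p 0 ^ 4 + 4 * φ 1 * p 0 ^ 3 * (p 1 + p (-1))
        + 6 * φ 2 * p 0 ^ 2 * (p 1 ^ 2 + p (-1) ^ 2) + 4 * φ 3 * p 0 * (p 1 ^ 3 + p (-1) ^ 3)
        + φ 4 * (p 1 ^ 4 + p (-1) ^ 4)
        + φ 5 * ((p 0 + p 1 + p (-1)) ^ 4 - (p 0 ^ 4 + 4 * p 0 ^ 3 * (p 1 + p (-1))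
        + 6 * p 0 ^ 2 * (p 1 ^ 2 + p (-1) ^ 2) + 4 * p 0 * (p 1 ^ 3 + p (-1) ^ 3)
        + (p 1 ^ 4 + p (-1) ^ 4))) := by
  have hs : ∀ f : SignType → ℝ, ∑ s, f s = f 0 + (f (-1) + f 1) := by
    intro f
    rw [univ_signType, sum_insert (by decide), sum_insert (by decide), sum_singleton]
  simp only [hs]
  simp [quadType]
  ring

lemma levelHat_sub (g : Vec n → ZMod 2) (x : Vec n) :
    levelHat g 1 x - levelHat g (-1) x = hat (fun y => ((spec g y : ℤ) : ℝ)) x := by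
  simp only [levelHat, hat, ← sum_sub_distrib]
  refine sum_congr rfl fun y _ => ?_
  generalize spec g y = s
  rcases s with _ | _ | _ <;> simp

lemma levelHat_add (g : Vec n → ZMod 2) (x : Vec n) :
    levelHat g 1 x + levelHat g (-1) x = hat (fun y => ((spec g y : ℤ) : ℝ) ^ 2) x := by
  simp only [levelHat, hat, ← sum_add_distrib]
  refine sum_congr rfl fun y _ => ?_
  generalize spec g y = s
  rcases s with _ | _ | _ <;> simp

lemma levelHat_add_add (g : Vec n → ZMod 2) (x : Vec n) :
    levelHat g 0 x + levelHat g 1 x + levelHat g (-1) x = if x = 0 then 2 ^ n else 0 := by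
  rw [← sum_sgn_ip_cast (R := ℝ)]
  simp only [levelHat, hat, ← sum_add_distrib, ip_comm x]
  refine sum_congr rfl fun y _ => ?_
  generalize spec g y = s
  rcases s with _ | _ | _ <;> simp

lemma walsh_cast (g : Vec n → ZMod 2) (y : Vec n) :
    ((walsh g y : ℤ) : ℝ) = hat (fun x => (sgn (g x) : ℝ)) y := by
  rw [walsh_eq_hat, hat_cast]

lemma hat_const_mul {R : Type*} [CommRing R] (c : R) (u : Vec n → R) (x : Vec n) :
    hat (fun y => c * u y) x = c * hat u x := by
  simp only [hat, mul_sum, mul_assoc]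

lemma Plat.hat_spec {g : Vec n → ZMod 2} (hg : Plat k g) (x : Vec n) :
    2 ^ k * hat (fun y => ((spec g y : ℤ) : ℝ)) x = 2 ^ n * sgn (g x) := by
  rw [← hat_hat (fun x => (sgn (g x) : ℝ)), ← hat_const_mul]
  congr 1
  funext y
  rw [← walsh_cast, hg y]
  push_cast; rfl

lemma Plat.hat_spec_sq {g : Vec n → ZMod 2} (hg : Plat k g) (hn : n + 1 = 2 * k) (x : Vec n) :
    2 * hat (fun y => ((spec g y : ℤ) : ℝ) ^ 2) x = autoCorr g x := by
  have h : (2 : ℝ) ^ (2 * k) * hat (fun y => ((spec g y : ℤ) : ℝ) ^ 2) x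
      = 2 ^ n * autoCorr g x := by
    trans hat (hat (corr (fun x => (sgn (g x) : ℝ)) fun x => (sgn (g x) : ℝ))) x
    · rw [← hat_const_mul]
      congr 1
      funext y
      rw [hat_corr, ← walsh_cast, hg y]
      push_cast; ring
    · rw [hat_hat]; rfl
  rw [← hn, pow_succ, mul_assoc] at h
  exact mul_left_cancel₀ (by positivity) h

lemma autoCorr_zero (g : Vec n → ZMod 2) : autoCorr g 0 = 2 ^ n := by
  have : ∀ y, (sgn (g y) : ℝ) * sgn (g y) = 1 := fun y => by
    rw [← Int.cast_mul, sgn_mul_self, Int.cast_one]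
  simp [autoCorr, this, ZMod.card]

lemma Plat.sum_autoCorr_sq {g : Vec n → ZMod 2} (hg : Plat k g) (hn : n + 1 = 2 * k) :
    ∑ x, autoCorr g x ^ 2 = 2 * (2 ^ n) ^ 2 := by
  have h1 : ∀ x, autoCorr g x ^ 2 = 4 * (hat (fun y => ((spec g y : ℤ) : ℝ) ^ 2) x *
      hat (fun y => ((spec g y : ℤ) : ℝ) ^ 2) x) := fun x => by
    rw [← hg.hat_spec_sq hn]; ring
  simp only [h1]
  rw [← mul_sum, sum_hat_mul_hat]
  have h2 := hg.hat_spec_sq hn 0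
  rw [autoCorr_zero] at h2
  have h3 : ∑ y, ((spec g y : ℤ) : ℝ) ^ 2 * ((spec g y : ℤ) : ℝ) ^ 2
      = hat (fun y => ((spec g y : ℤ) : ℝ) ^ 2) 0 := by
    simp only [hat, ip_zero_right, sgn_zero, Int.cast_one, mul_one]
    refine sum_congr rfl fun y _ => ?_
    generalize spec g y = s
    rcases s with _ | _ | _ <;> simp
  rw [h3]
  linear_combination 2 * 2 ^ n * h2

lemma Plat.hat_spec_mul_self {g : Vec n → ZMod 2} (hg : Plat k g) (hn : n + 1 = 2 * k) (x : Vec n) :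
    2 * hat (fun y => ((spec g y : ℤ) : ℝ)) x ^ 2 = 2 ^ n := by
  have h := congrArg (· ^ 2) (hg.hat_spec x)
  have h1 : (sgn (g x) : ℝ) * sgn (g x) = 1 := by
    rw [← Int.cast_mul, sgn_mul_self, Int.cast_one]
  have h2 : ((2 : ℝ) ^ k) ^ 2 = 2 ^ n * 2 := by rw [← pow_mul, mul_comm k, ← hn, pow_succ]
  simp only [mul_pow, h2] at h
  have h3 : (2 : ℝ) ^ n * (2 * hat (fun y => ((spec g y : ℤ) : ℝ)) x ^ 2) = 2 ^ n * 2 ^ n := by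
    linear_combination h + (2 ^ n * 2 ^ n) * h1
  exact mul_left_cancel₀ (by positivity) h3

lemma five_lt : Real.logb 2 5 < 72 / 31 := by
  rw [Real.logb_lt_iff_lt_rpow (by norm_num) (by norm_num)]
  refine lt_of_pow_lt_pow_left₀ 31 (by positivity) ?_
  rw [← Real.rpow_natCast ((2 : ℝ) ^ (72 / 31 : ℝ)), ← Real.rpow_mul (by norm_num)]
  norm_num

lemma lt_five : 2 < Real.logb 2 5 := by
  rw [Real.lt_logb_iff_rpow_lt (by norm_num) (by norm_num)]
  norm_num

lemma three_lt : Real.logb 2 3 < 65 / 41 := by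
  rw [Real.logb_lt_iff_lt_rpow (by norm_num) (by norm_num)]
  refine lt_of_pow_lt_pow_left₀ 41 (by positivity) ?_
  rw [← Real.rpow_natCast ((2 : ℝ) ^ (65 / 41 : ℝ)), ← Real.rpow_mul (by norm_num)]
  norm_num

lemma lt_three : 84 / 53 < Real.logb 2 3 := by
  rw [Real.lt_logb_iff_rpow_lt (by norm_num) (by norm_num)]
  refine lt_of_pow_lt_pow_left₀ 53 (by positivity) ?_
  rw [← Real.rpow_natCast ((2 : ℝ) ^ (84 / 53 : ℝ)), ← Real.rpow_mul (by norm_num)]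
  norm_num

lemma logb_two_two_pow (m : ℕ) : Real.logb 2 (2 ^ m) = m := by
  rw [Real.logb_pow]; simp

lemma cost_zero : cost 0 = 2 * Real.logb 2 3 - 3 := by
  have := logb_two_two_pow 3
  rw [cost, show wt 0 = 2 ^ 3 / 3 ^ 2 by norm_num [wt], Real.logb_div (by norm_num) (by norm_num),
    this, Real.logb_pow]
  push_cast; ring

lemma cost_one : cost 1 = Real.logb 2 5 - 2 := by
  have := logb_two_two_pow 2
  rw [cost, show wt 1 = 2 ^ 2 / 5 by norm_num [wt], Real.logb_div (by norm_num) (by norm_num), this]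
  push_cast; ring

lemma cost_two : cost 2 = 1 := by
  rw [cost, show wt 2 = 2⁻¹ by rw [show wt 2 = 1 / 2 from rfl]; norm_num, Real.logb_inv, neg_neg,
    Real.logb_self_eq_one (by norm_num)]

lemma cost_three : cost 3 = Real.logb 2 5 := by
  rw [cost, show wt 3 = 5⁻¹ by rw [show wt 3 = 1 / 5 from rfl]; norm_num, Real.logb_inv, neg_neg]

lemma cost_four : cost 4 = 2 * Real.logb 2 3 := by
  rw [cost, show wt 4 = (3 ^ 2)⁻¹ by rw [show wt 4 = 1 / 9 from rfl]; norm_num,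
    Real.logb_inv, neg_neg, Real.logb_pow]
  push_cast; ring

lemma cost_five : cost 5 = 0 := by
  rw [cost, show wt 5 = 1 from rfl, Real.logb_one, neg_zero]

/-- The cost of a quadruple, including the sign bits. -/
noncomputable def totalCost (t : Fin 6) : ℝ := cost t + if t = 4 then 2 else 0

/-- The pointwise contribution of frequencies to the average cost. -/
lemma sum_totalCost_eq {p : SignType → ℝ} :
    ∑ s₁, ∑ s₂, ∑ s₃, ∑ s₄, totalCost (quadType s₁ s₂ s₃ s₄) * (p s₁ * p s₂ * (p s₃ * p s₄))
      = (2 * Real.logb 2 3 - 3) * p 0 ^ 4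
        + 4 * (Real.logb 2 5 - 2) * p 0 ^ 3 * (p 1 + p (-1))
        + 6 * p 0 ^ 2 * (p 1 ^ 2 + p (-1) ^ 2)
        + 4 * Real.logb 2 5 * p 0 * (p 1 ^ 3 + p (-1) ^ 3)
        + (2 * Real.logb 2 3 + 2) * (p 1 ^ 4 + p (-1) ^ 4) := by
  have h : (0 : Fin 6) ≠ 4 ∧ (1 : Fin 6) ≠ 4 ∧ (2 : Fin 6) ≠ 4 ∧ (3 : Fin 6) ≠ 4 ∧
    (5 : Fin 6) ≠ 4 := by decide
  rw [sum_signType_quad]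
  simp only [totalCost, cost_zero, cost_one, cost_two, cost_three, cost_four, cost_five, h,
    if_false, if_true, add_zero, mul_one, zero_mul]

lemma Plat.levelHat_eq {g : Vec n → ZMod 2} (hg : Plat k g) (hn : n + 1 = 2 * k) (x : Vec n) :
    ∃ T : ℝ, T ^ 2 = 2 ^ n / 8 ∧ levelHat g 1 x = autoCorr g x / 4 + T ∧
      levelHat g (-1) x = autoCorr g x / 4 - T ∧
      levelHat g 0 x = (if x = 0 then 2 ^ n else 0) - autoCorr g x / 2 := by
  refine ⟨hat (fun y => ((spec g y : ℤ) : ℝ)) x / 2, ?_, ?_, ?_, ?_⟩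
  · linear_combination (1 / 8) * hg.hat_spec_mul_self hn x
  all_goals
    have h1 := levelHat_sub g x
    have h2 := levelHat_add g x
    have h3 := levelHat_add_add g x
    have h4 := hg.hat_spec_sq hn x
    linarith

lemma quartic_eq (c₀ c₁ c₃ c₄ q A T : ℝ) :
    c₀ * q ^ 4 + 4 * c₁ * q ^ 3 * (A / 4 + T + (A / 4 - T))
        + 6 * q ^ 2 * ((A / 4 + T) ^ 2 + (A / 4 - T) ^ 2)
        + 4 * c₃ * q * ((A / 4 + T) ^ 3 + (A / 4 - T) ^ 3)
        + c₄ * ((A / 4 + T) ^ 4 + (A / 4 - T) ^ 4)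
      = c₀ * q ^ 4 + 2 * c₁ * q ^ 3 * A + 6 * q ^ 2 * (A ^ 2 / 8 + 2 * T ^ 2)
        + c₃ * q * (A ^ 3 / 8 + 6 * A * T ^ 2)
        + c₄ * (A ^ 4 / 128 + 3 / 4 * A ^ 2 * T ^ 2 + 2 * (T ^ 2) ^ 2) := by
  ring

/-- If no derivative is strongly biased, the average cost of a quadruple is small. -/
lemma Plat.sum_totalCost_le {g : Vec n → ZMod 2} (hg : Plat k g) (hn : n + 1 = 2 * k)
    (hA : ∀ x ≠ 0, |autoCorr g x| ≤ 3 / 5 * 2 ^ n) :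
    ∑ a, ∑ b, ∑ y, totalCost (quad g a b y) ≤ 469 / 1000 * (2 ^ n) ^ 3 + 5 * (2 ^ n) ^ 2 := by
  have h3 := three_lt
  have h3' := lt_three
  have h5 := five_lt
  have h5' := lt_five
  have hN : (0 : ℝ) < 2 ^ n := by positivity
  have hN1 : (1 : ℝ) ≤ 2 ^ n := one_le_pow₀ (by norm_num)
  have hsq := hg.sum_autoCorr_sq hn
  rw [← add_sum_erase univ _ (mem_univ 0), autoCorr_zero] at hsq
  have hcard : ((univ.erase (0 : Vec n)).card : ℝ) ≤ 2 ^ n := by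
    exact_mod_cast (card_le_univ _).trans (card_vec (n := n)).le
  refine le_of_mul_le_mul_left ?_ hN
  rw [sum_quad]
  simp only [sum_totalCost_eq (p := fun s => levelHat g s _)]
  rw [← add_sum_erase univ _ (mem_univ 0)]
  obtain ⟨T, hT, hp, hm, h0⟩ := hg.levelHat_eq hn 0
  rw [hp, hm, h0, if_pos rfl, quartic_eq, hT, autoCorr_zero]
  have hx : ∀ x ∈ univ.erase (0 : Vec n), (2 * Real.logb 2 3 - 3) * levelHat g 0 x ^ 4
        + 4 * (Real.logb 2 5 - 2) * levelHat g 0 x ^ 3 * (levelHat g 1 x + levelHat g (-1) x)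
        + 6 * levelHat g 0 x ^ 2 * (levelHat g 1 x ^ 2 + levelHat g (-1) x ^ 2)
        + 4 * Real.logb 2 5 * levelHat g 0 x * (levelHat g 1 x ^ 3 + levelHat g (-1) x ^ 3)
        + (2 * Real.logb 2 3 + 2) * (levelHat g 1 x ^ 4 + levelHat g (-1) x ^ 4)
      ≤ autoCorr g x ^ 2 * ((9 / 25) * (2 ^ n) ^ 2 * ((2 * Real.logb 2 3 - 3) / 16
          - (Real.logb 2 5 - 2) / 4 + 3 / 16 - Real.logb 2 5 / 16 + (2 * Real.logb 2 3 + 2) / 128)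
          + 2 ^ n) + (2 ^ n) ^ 2 := by
    intro x hx
    have hx0 := (mem_erase.mp hx).1
    obtain ⟨T, hT, hp, hm, h0⟩ := hg.levelHat_eq hn x
    rw [hp, hm, h0, if_neg hx0, quartic_eq, hT]
    have hA := sq_le_sq' (abs_le.mp (hA x hx0)).1 (abs_le.mp (hA x hx0)).2
    generalize Real.logb 2 3 = L3 at *
    generalize Real.logb 2 5 = L5 at *
    generalize (2 : ℝ) ^ n = N at *
    generalize autoCorr g x = A at *
    have hK : 0 ≤ (2 * L3 - 3) / 16 - (L5 - 2) / 4 + 3 / 16 - L5 / 16 + (2 * L3 + 2) / 128 := by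
      linarith
    have e1 := mul_le_mul_of_nonneg_left hA (mul_nonneg (sq_nonneg A) hK)
    have e2 := mul_nonneg (mul_nonneg (sq_nonneg A) hN.le) (by linarith :
      0 ≤ 1 - (3 - 3 * L5 + 3 / 4 * (2 * L3 + 2)) / 8)
    have e3 := mul_nonneg (sq_nonneg N) (by linarith : 0 ≤ 1 - (2 * L3 + 2) / 32)
    linarith
  refine (add_le_add_right (sum_le_sum hx) _).trans ?_
  rw [sum_add_distrib, ← sum_mul, sum_const, nsmul_eq_mul]
  have hsq' : ∑ x ∈ univ.erase (0 : Vec n), autoCorr g x ^ 2 = (2 ^ n) ^ 2 := by linarith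
  rw [hsq']
  have e0 := mul_le_mul_of_nonneg_right hcard (sq_nonneg ((2 : ℝ) ^ n))
  refine (add_le_add_right (add_le_add_right e0 _) _).trans ?_
  generalize Real.logb 2 3 = L3 at *
  generalize Real.logb 2 5 = L5 at *
  generalize (2 : ℝ) ^ n = N at *
  have hN4 : 0 ≤ N ^ 4 := by positivity
  have hN3 : 0 ≤ N ^ 3 := by positivity
  have hN2 : 0 ≤ N ^ 2 * (N - 1) := mul_nonneg (sq_nonneg N) (by linarith)
  have e1 := mul_nonneg hN4 (by linarith : 0 ≤ 469 / 1000 -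
    ((2 * L3 - 3) / 16 + (L5 - 2) / 4 + 3 / 16 + L5 / 16 + (2 * L3 + 2) / 128
    + 9 / 25 * ((2 * L3 - 3) / 16 - (L5 - 2) / 4 + 3 / 16 - L5 / 16 + (2 * L3 + 2) / 128)))
  have e2 := mul_nonneg hN3 (by linarith : 0 ≤ 19 / 10 -
    (3 + 3 * L5 + 3 / 4 * (2 * L3 + 2)) / 8)
  have e3 := mul_nonneg (sq_nonneg N) (by linarith : 0 ≤ 1 - (2 * L3 + 2) / 32)
  linarith

lemma ipS_add_right (x y y' : Split d) : ipS x (y + y') = ipS x y + ipS x y' := by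
  simp only [ipS, Prod.fst_add, Prod.snd_add, ip_add_right]; ring

lemma ipS_comm (x y : Split d) : ipS x y = ipS y x := by
  simp only [ipS, ip_comm x.1, mul_comm]

lemma ipS_smul_right (c : ZMod 2) (x y : Split d) : ipS x (c • y) = c * ipS x y := by
  simp only [ipS, Prod.smul_fst, Prod.smul_snd, ip_smul_right, smul_eq_mul]; ring

/-- The functional `ipS x`. -/
def ipSLin (x : Split d) : Split d →ₗ[ZMod 2] ZMod 2 where
  toFun := ipS x
  map_add' := ipS_add_right x
  map_smul' c y := ipS_smul_right c x y

lemma ipS_injective {x x' : Split d} (h : ∀ y, ipS x y = ipS x' y) : x = x' := by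
  obtain ⟨x, i, j⟩ := x
  obtain ⟨x', i', j'⟩ := x'
  have h1 : x = x' := by
    funext l
    simpa [ipS, ip, Pi.single_apply] using h (Pi.single l 1, 0, 0)
  have h2 := h (0, 1, 0)
  have h3 := h (0, 0, 1)
  simp only [ipS, ip_zero_right, mul_zero, mul_one, zero_add, add_zero] at h2 h3
  rw [h1, h2, h3]

lemma linear_eq_ip (ψ : Vec n →ₗ[ZMod 2] ZMod 2) (z : Vec n) :
    ψ z = ip (fun i => ψ (Pi.single i 1)) z := by
  rw [LinearMap.pi_apply_eq_sum_univ ψ z, ip]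
  refine sum_congr rfl fun i _ => ?_
  rw [smul_eq_mul, mul_comm]
  congr 2
  funext j
  simp [Pi.single_apply, eq_comm]

lemma card_split : Fintype.card (Split d) = Fintype.card (Vec (d + 2)) := by
  simp [ZMod.card, pow_succ, mul_assoc]

lemma exists_dual (M : Split d ≃ₗ[ZMod 2] Vec (d + 2)) :
    ∃ N : Split d → Vec (d + 2), Function.Bijective N ∧ ∀ x y, ip (N x) (M y) = ipS x y := by
  let N : Split d → Vec (d + 2) := fun x i => ipSLin x (M.symm (Pi.single i 1))
  have hMN : ∀ x y, ip (N x) (M y) = ipS x y := fun x y => by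
    refine (linear_eq_ip (ipSLin x ∘ₗ M.symm.toLinearMap) (M y)).symm.trans ?_
    rw [LinearMap.comp_apply, LinearEquiv.coe_coe, LinearEquiv.symm_apply_apply]
    rfl
  refine ⟨N, (Fintype.bijective_iff_injective_and_card N).mpr ⟨fun x x' h => ?_, card_split⟩, hMN⟩
  exact ipS_injective fun y => by rw [← hMN, ← hMN, h]

/-- Coordinates on 𝔽₂ⁿ in which two given independent vectors become the last two basis vectors,
together with the dual coordinates. -/
lemma exists_coordinates (a b : Vec (d + 2)) (ha : a ≠ 0) (hb : b ≠ 0) (hab : a ≠ b) :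
    ∃ M N : Split d → Vec (d + 2), Function.Bijective M ∧ Function.Bijective N ∧
      (∀ x y, M (x + y) = M x + M y) ∧ M (0, 1, 0) = a ∧ M (0, 0, 1) = b ∧
      ∀ x y, ip (N x) (M y) = ipS x y := by
  let l : (ZMod 2 × ZMod 2) →ₗ[ZMod 2] Vec (d + 2) :=
    LinearMap.coprod (LinearMap.toSpanSingleton _ _ a) (LinearMap.toSpanSingleton _ _ b)
  have hl : Function.Injective l := by
    rw [injective_iff_map_eq_zero]
    rintro ⟨i, j⟩ h
    have h : i • a + j • b = 0 := h
    suffices ∀ i j : ZMod 2, i • a + j • b = 0 → (i, j) = (0, 0) from this i j h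
    refine forall_zmod_two.mpr ⟨forall_zmod_two.mpr ⟨fun _ => rfl, fun h => absurd ?_ hb⟩,
      forall_zmod_two.mpr ⟨fun h => absurd ?_ ha, fun h => absurd ?_ hab⟩⟩
    · simpa using h
    · simpa using h
    · simpa [add_eq_zero_iff_vec] using h
  obtain ⟨C, hC⟩ := Submodule.exists_isCompl (LinearMap.range l)
  have hfin : Module.finrank (ZMod 2) (Vec d) = Module.finrank (ZMod 2) C := by
    have h1 := Submodule.finrank_add_eq_of_isCompl hC
    rw [LinearMap.finrank_range_of_inj hl] at h1
    simp only [Module.finrank_prod, Module.finrank_self, Module.finrank_fin_fun] at h1 ⊢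
    omega
  let e := LinearEquiv.ofFinrankEq (Vec d) C hfin
  let M₀ : Split d →ₗ[ZMod 2] Vec (d + 2) := LinearMap.coprod (C.subtype ∘ₗ e.toLinearMap) l
  have hM₀ : Function.Injective M₀ := by
    rw [injective_iff_map_eq_zero]
    rintro ⟨x, p⟩ h
    have h : (e x : Vec (d + 2)) + l p = 0 := h
    have h1 : (e x : Vec (d + 2)) = l p := add_eq_zero_iff_vec.mp h
    have h2 : (e x : Vec (d + 2)) = 0 :=
      (Submodule.disjoint_def.mp hC.disjoint) _ (h1 ▸ LinearMap.mem_range_self l p) (e x).2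
    have h3 : x = 0 := by simpa using h2
    have h4 : p = 0 := (injective_iff_map_eq_zero l).mp hl p (h1.symm.trans h2)
    rw [h3, h4]; rfl
  have hM : Function.Bijective M₀ :=
    (Fintype.bijective_iff_injective_and_card M₀).mpr ⟨hM₀, card_split⟩
  obtain ⟨N, hN, hMN⟩ := exists_dual (LinearEquiv.ofBijective M₀ hM)
  exact ⟨M₀, N, hM, hN, map_add M₀, by simp [M₀, l], by simp [M₀, l], hMN⟩

lemma eq_two_pow_mul_sign {w : ℤ} (s : SignType) (h : w = 2 ^ k * (s : ℤ)) :
    w = 2 ^ k * (SignType.sign w : ℤ) := by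
  have h2 : (0 : ℤ) < 2 ^ k := by positivity
  rcases s with _ | _ | _
  · simp [h]
  · simp [h, h2]
  · simp [h, h2]

lemma walsh_eq_sum (g : Vec n → ZMod 2) (y : Vec n) : walsh g y = ∑ x, sgn (g x + ip x y) := rfl

section Transport

variable {M N : Split d → Vec n}

/-- A function read in affine coordinates. -/
def shiftRead (M : Split d → Vec n) (u : Vec n) (g : Vec n → ZMod 2) : Split d → ZMod 2 :=
  fun x => g (M x + u)

/-- A function read in linear coordinates, after adding a linear functional. -/
def twistRead (N : Split d → Vec n) (u : Vec n) (g : Vec n → ZMod 2) : Split d → ZMod 2 :=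
  fun x => g (N x) + ip (N x) u

lemma shiftRead_injective (hM : Function.Bijective M) (u : Vec n) :
    Function.Injective (shiftRead M u) := by
  intro g g' h
  funext z
  obtain ⟨x, hx⟩ := hM.2 (z + u)
  have h1 := congrFun h x
  simpa only [shiftRead, hx, add_assoc, add_self_vec, add_zero] using h1

lemma twistRead_injective (hN : Function.Bijective N) (u : Vec n) :
    Function.Injective (twistRead N u) := by
  intro g g' h
  funext z
  obtain ⟨x, rfl⟩ := hN.2 z
  exact add_right_cancel (congrFun h x)

lemma walshS_shiftRead (hM : Function.Bijective M) (hMN : ∀ x y, ip (N x) (M y) = ipS x y)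
    (u : Vec n) (g : Vec n → ZMod 2) (y : Split d) :
    walshS (shiftRead M u g) y = sgn (ip u (N y)) * walsh g (N y) := by
  rw [walsh_eq_sum, mul_sum, ← sum_add_right_vec u, ← hM.sum_comp]
  refine sum_congr rfl fun x _ => ?_
  have h := CharTwo.add_self_eq_zero (ip u (N y))
  rw [← sgn_add, ip_add_left, shiftRead, ip_comm (M x), hMN, ipS_comm y x]
  congr 1
  linear_combination -h

lemma walshS_twistRead (hN : Function.Bijective N) (hMN : ∀ x y, ip (N x) (M y) = ipS x y)
    (u : Vec n) (g : Vec n → ZMod 2) (y : Split d) :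
    walshS (twistRead N u g) y = walsh g (u + M y) := by
  rw [walsh_eq_sum, ← hN.sum_comp]
  refine sum_congr rfl fun x _ => ?_
  rw [ip_add_right, hMN, twistRead, add_assoc]

lemma Plat.shiftRead {g : Vec n → ZMod 2} (hg : Plat k g) (hM : Function.Bijective M)
    (hMN : ∀ x y, ip (N x) (M y) = ipS x y) (u : Vec n) : PlatS k (shiftRead M u g) := by
  intro y
  have h := walshS_shiftRead hM hMN u g y
  rw [hg (N y)] at h
  have hs : ∀ c : ZMod 2, sgn c = 1 ∨ sgn c = -1 := by decide
  rcases hs (ip u (N y)) with hc | hc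
  · exact eq_two_pow_mul_sign (spec g (N y)) (by rw [h, hc, one_mul])
  · refine eq_two_pow_mul_sign (-spec g (N y)) ?_
    rw [h, hc]
    generalize spec g (N y) = s
    rcases s with _ | _ | _ <;> simp

lemma Plat.twistRead {g : Vec n → ZMod 2} (hg : Plat k g) (hN : Function.Bijective N)
    (hMN : ∀ x y, ip (N x) (M y) = ipS x y) (u : Vec n) : PlatS k (twistRead N u g) := fun y =>
  eq_two_pow_mul_sign (spec g (u + M y)) (by rw [walshS_twistRead hN hMN, hg])

lemma typeS_twistRead (hN : Function.Bijective N) (hMN : ∀ x y, ip (N x) (M y) = ipS x y)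
    (hMa : ∀ x y, M (x + y) = M x + M y) (u : Vec n) (g : Vec n → ZMod 2) (y : Vec d) :
    typeS (BentCount.twistRead N u g) y
      = quad g (M (0, 1, 0)) (M (0, 0, 1)) (u + M (y, 0, 0)) := by
  have h1 : M (y, 1, 0) = M (y, 0, 0) + M (0, 1, 0) := by rw [← hMa]; simp
  have h2 : M (y, 0, 1) = M (y, 0, 0) + M (0, 0, 1) := by rw [← hMa]; simp
  have h3 : M (y, 1, 1) = M (y, 0, 0) + M (0, 0, 1) + M (0, 1, 0) := by simp [← hMa]
  simp only [typeS, specS, walshS_twistRead hN hMN, quad, spec, h1, h2, h3, add_assoc]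

end Transport

lemma card_le_of_cover {Γ Γ' P : Type*} (s : Finset Γ) (p : Finset P)
    (Φ : P → Γ → Γ') (good : P → Γ' → Prop) {B : ℝ} (hinj : ∀ i ∈ p, Function.Injective (Φ i))
    (hcover : ∀ g ∈ s, ∃ i ∈ p, good i (Φ i g))
    (hgood : ∀ i ∈ p, ∀ t : Finset Γ', (∀ G ∈ t, good i G) → (t.card : ℝ) ≤ B) :
    (s.card : ℝ) ≤ p.card * B := by
  classical
  have h1 : s ⊆ p.biUnion fun i => s.filter fun g => good i (Φ i g) := fun g hg => by
    obtain ⟨i, hi, h⟩ := hcover g hg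
    exact mem_biUnion.mpr ⟨i, hi, mem_filter.mpr ⟨hg, h⟩⟩
  calc (s.card : ℝ) ≤ ∑ i ∈ p, ((s.filter fun g => good i (Φ i g)).card : ℝ) := by
        exact_mod_cast (card_le_card h1).trans card_biUnion_le
    _ ≤ ∑ _i ∈ p, B := sum_le_sum fun i hi => by
        rw [← card_image_of_injective _ (hinj i hi)]
        refine hgood i hi _ fun G hG => ?_
        obtain ⟨g, hg, rfl⟩ := mem_image.mp hG
        exact (mem_filter.mp hg).2
    _ = p.card * B := by rw [sum_const, nsmul_eq_mul]

/-- The number of arguments where the derivative in direction `a` differs from `c`. -/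
noncomputable def mismatch (g : Vec n → ZMod 2) (a : Vec n) (c : ZMod 2) : ℝ :=
  ∑ z, if g (z + a) = g z + c then 0 else 1

lemma exists_mismatch_le {g : Vec n → ZMod 2} {a : Vec n}
    (h : 3 / 5 * 2 ^ n < |autoCorr g a|) : ∃ c, mismatch g a c ≤ 2 ^ n / 5 := by
  have hN : ∑ _z : Vec n, (1 : ℝ) = 2 ^ n := by simp [ZMod.card]
  have h0 : autoCorr g a + 2 * mismatch g a 0 = 2 ^ n := by
    rw [← hN, autoCorr, mismatch, mul_sum, ← sum_add_distrib]
    refine sum_congr rfl fun z _ => ?_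
    generalize g z = p
    generalize g (z + a) = q
    revert p q
    simp only [forall_zmod_two]
    norm_num
  have h1 : mismatch g a 0 + mismatch g a 1 = 2 ^ n := by
    rw [← hN, mismatch, mismatch, ← sum_add_distrib]
    refine sum_congr rfl fun z _ => ?_
    generalize g z = p
    generalize g (z + a) = q
    revert p q
    simp only [forall_zmod_two]
    simp only [zero_add, add_zero, show (1 : ZMod 2) + 1 = 0 from rfl]
    norm_num
  rcases lt_abs.mp h with h | h
  · exact ⟨0, by linarith⟩
  · exact ⟨1, by linarith⟩

lemma exists_sum_mismatch_le {M : Split d → Vec n} (hMa : ∀ x y, M (x + y) = M x + M y)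
    (g : Vec n → ZMod 2) (c : ZMod 2) (A : Finset (Vec d × ZMod 2)) :
    ∃ u, 2 ^ n * ∑ y ∈ A, (if shiftRead M u g (y.1, 1, y.2) = shiftRead M u g (y.1, 0, y.2) + c
      then (0 : ℝ) else 1) ≤ A.card * mismatch g (M (0, 1, 0)) c := by
  by_contra! hcon
  have h := sum_lt_sum_of_nonempty (univ_nonempty (α := Vec n)) fun u _ => hcon u
  rw [sum_const, card_vec, nsmul_eq_mul, ← mul_sum, sum_comm] at h
  refine absurd h (not_lt.mpr (le_of_eq ?_))
  rw [Nat.cast_pow, Nat.cast_ofNat]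
  congr 1
  rw [← nsmul_eq_mul, ← sum_const]
  refine sum_congr rfl fun y _ => ?_
  refine Eq.trans (sum_congr rfl fun u _ => ?_) (sum_add_left_vec (M (y.1, 0, y.2)) fun z =>
    if g (z + M (0, 1, 0)) = g z + c then (0 : ℝ) else 1)
  have h1 : M (y.1, 1, y.2) = M (y.1, 0, y.2) + M (0, 1, 0) := by rw [← hMa]; simp
  simp only [shiftRead, h1, add_right_comm]

lemma exists_not_mem_pair (a : Vec (d + 2)) : ∃ b : Vec (d + 2), b ≠ 0 ∧ a ≠ b := by
  classical
  have h : ({0, a} : Finset (Vec (d + 2))).card < (univ : Finset (Vec (d + 2))).card := by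
    rw [card_vec]
    have := card_le_two (a := (0 : Vec (d + 2))) (b := a)
    have := Nat.one_le_two_pow (n := d)
    rw [pow_add]; omega
  obtain ⟨b, -, hb⟩ := exists_mem_notMem_of_card_lt_card h
  simp only [mem_insert, mem_singleton, not_or] at hb
  exact ⟨b, hb.1, Ne.symm hb.2⟩

/-- There are few plateaued functions with a strongly biased derivative. -/
lemma card_biased_le (hd : d + 3 = 2 * k) (s : Finset (Vec (d + 2) → ZMod 2))
    (hs : ∀ g ∈ s, Plat k g ∧ ∃ a ≠ 0, 3 / 5 * 2 ^ (d + 2) < |autoCorr g a|) :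
    (s.card : ℝ) ≤ 2 * (2 ^ (d + 2)) ^ 3 *
      2 ^ ((2 * Real.logb 2 5 - 6 / 5) * (ball d k).card) := by
  classical
  choose! M N hM hN hMa hM1 hM2 hMN using exists_coordinates (d := d)
  let p : Finset (Vec (d + 2) × Vec (d + 2) × Vec (d + 2) × ZMod 2) :=
    univ.filter fun i => i.1 ≠ 0 ∧ i.2.1 ≠ 0 ∧ i.1 ≠ i.2.1
  have hp : (p.card : ℝ) ≤ 2 * (2 ^ (d + 2)) ^ 3 := by
    have h1 : p.card ≤ 2 * (2 ^ (d + 2)) ^ 3 := by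
      refine (card_le_univ p).trans (le_of_eq ?_)
      rw [Fintype.card_prod, Fintype.card_prod, Fintype.card_prod, ZMod.card, ← card_univ, card_vec]
      ring
    exact_mod_cast h1
  refine (card_le_of_cover s p (fun i => shiftRead (M i.1 i.2.1) i.2.2.1)
    (fun i G => PlatS k G ∧ ∑ y ∈ ball d k ×ˢ univ,
      (if G (y.1, 1, y.2) = G (y.1, 0, y.2) + i.2.2.2 then (0 : ℝ) else 1)
        ≤ 2 / 5 * (ball d k).card) ?_ ?_
    fun i _ t ht => card_pair_le hd i.2.2.2 t ht).trans
    (mul_le_mul_of_nonneg_right hp (by positivity))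
  · intro i hi
    obtain ⟨h1, h2, h3⟩ := (mem_filter.mp hi).2
    exact shiftRead_injective (hM _ _ h1 h2 h3) _
  · intro g hg
    obtain ⟨hgp, a, ha, hag⟩ := hs g hg
    obtain ⟨b, hb, hab⟩ := exists_not_mem_pair a
    obtain ⟨c, hc⟩ := exists_mismatch_le hag
    obtain ⟨u, hu⟩ := exists_sum_mismatch_le (hMa a b ha hb hab) g c (ball d k ×ˢ univ)
    refine ⟨(a, b, u, c), mem_filter.mpr ⟨mem_univ _, ha, hb, hab⟩,
      hgp.shiftRead (hM a b ha hb hab) (hMN a b ha hb hab) u, ?_⟩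
    rw [hM1 a b ha hb hab, card_product, card_univ, ZMod.card] at hu
    refine le_of_mul_le_mul_left (hu.trans ?_) (show (0 : ℝ) < 2 ^ (d + 2) by positivity)
    refine (mul_le_mul_of_nonneg_left hc (by positivity)).trans (le_of_eq ?_)
    push_cast; ring

lemma totalCost_nonneg (t : Fin 6) : 0 ≤ totalCost t :=
  add_nonneg (cost_nonneg t) (by split_ifs <;> norm_num)

lemma sum_cost_twistRead_le (hd : d + 3 = 2 * k) {M N : Split d → Vec n}
    (hN : Function.Bijective N) (hMN : ∀ x y, ip (N x) (M y) = ipS x y)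
    (hMa : ∀ x y, M (x + y) = M x + M y) (g : Vec n → ZMod 2) :
    ∑ u, (∑ y ∈ ball d k, cost (typeS (twistRead N u g) y)
      + ∑ y, (if typeS (twistRead N u g) y = 4 then (1 : ℝ) else 0))
      ≤ (ball d k).card * ∑ z, totalCost (quad g (M (0, 1, 0)) (M (0, 0, 1)) z) := by
  have h4 : ((univ : Finset (Vec d)).card : ℝ) ≤ (ball d k).card * 2 := by
    rw [card_vec, card_ball, mul_comm]
    exact_mod_cast two_pow_le_two_mul_ballCard hd
  simp only [typeS_twistRead hN hMN hMa]
  rw [sum_add_distrib, sum_comm, sum_comm (s := univ) (t := univ (α := Vec d))]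
  rw [sum_congr rfl fun y _ => sum_add_right_vec (M (y, 0, 0)) fun z =>
    cost (quad g (M (0, 1, 0)) (M (0, 0, 1)) z),
    sum_congr rfl fun y _ => sum_add_right_vec (M (y, 0, 0)) fun z =>
    if quad g (M (0, 1, 0)) (M (0, 0, 1)) z = 4 then (1 : ℝ) else 0]
  rw [sum_const, sum_const, nsmul_eq_mul, nsmul_eq_mul]
  simp only [totalCost]
  rw [sum_add_distrib, mul_add]
  refine add_le_add_right ((mul_le_mul_of_nonneg_right h4 ?_).trans (le_of_eq ?_)) _
  · exact sum_nonneg fun z _ => by split_ifs <;> norm_num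
  · rw [mul_assoc, mul_sum]
    congr 1
    exact sum_congr rfl fun z _ => by split_ifs <;> norm_num

lemma exists_cheap_flat {g : Vec n → ZMod 2} (hg : Plat k g) (hn : n + 1 = 2 * k)
    (hA : ∀ x ≠ 0, |autoCorr g x| ≤ 3 / 5 * 2 ^ n) (hN : (65000 : ℝ) ≤ 2 ^ n) {B : ℝ} (hB : 0 < B)
    {c : Vec n → Vec n → Vec n → ℝ} (hc : ∀ a b, a ≠ 0 → b ≠ 0 → a ≠ b →
      ∑ u, c a b u ≤ B * ∑ z, totalCost (quad g a b z)) :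
    ∃ a b u, a ≠ 0 ∧ b ≠ 0 ∧ a ≠ b ∧ c a b u ≤ 4691 / 10000 * B := by
  classical
  by_contra! hcon
  have h1 : ∀ a b : Vec n, 2 ^ n * (4691 / 10000) * (1 - (if a = 0 then 1 else 0)
      - (if b = 0 then 1 else 0) - (if a = b then 1 else 0)) ≤ ∑ z, totalCost (quad g a b z) := by
    intro a b
    have h0 : 0 ≤ ∑ z, totalCost (quad g a b z) := sum_nonneg fun z _ => totalCost_nonneg _
    by_cases hab : a ≠ 0 ∧ b ≠ 0 ∧ a ≠ b
    · rw [if_neg hab.1, if_neg hab.2.1, if_neg hab.2.2]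
      have h2 := (sum_le_sum fun u _ => (hcon a b u hab.1 hab.2.1 hab.2.2).le).trans
        (hc a b hab.1 hab.2.1 hab.2.2)
      rw [sum_const, card_vec, nsmul_eq_mul] at h2
      push_cast at h2
      refine le_of_mul_le_mul_left (le_trans (le_of_eq ?_) h2) hB
      ring
    · refine le_trans (mul_nonpos_of_nonneg_of_nonpos (by positivity) ?_) h0
      by_cases ha : a = 0
      · rw [if_pos ha]; split_ifs <;> norm_num
      · by_cases hb : b = 0
        · rw [if_pos hb]; split_ifs <;> norm_num
        · rw [if_pos (not_not.mp fun h => hab ⟨ha, hb, h⟩)]; split_ifs; norm_num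
  have h2 := (sum_le_sum fun a _ => sum_le_sum fun b _ => h1 a b).trans
    (hg.sum_totalCost_le hn hA)
  simp only [← mul_sum, sum_sub_distrib, sum_const, card_vec, nsmul_eq_mul, sum_ite_eq,
    sum_ite_eq', mem_univ, if_true] at h2
  push_cast at h2
  generalize (2 : ℝ) ^ n = N at *
  have h3 := mul_nonneg (sq_nonneg N) (by linarith : 0 ≤ N - 65000)
  have hN0 : 0 < N := by linarith
  have h4 : 0 < N ^ 2 := by positivity
  linarith

/-- There are few plateaued functions without a strongly biased derivative. -/
lemma card_unbiased_le (hd : d + 3 = 2 * k) (hN : (65000 : ℝ) ≤ 2 ^ (d + 2))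
    (s : Finset (Vec (d + 2) → ZMod 2))
    (hs : ∀ g ∈ s, Plat k g ∧ ∀ a ≠ 0, |autoCorr g a| ≤ 3 / 5 * 2 ^ (d + 2)) :
    (s.card : ℝ) ≤ (2 ^ (d + 2)) ^ 3 *
      2 ^ (3 * ((ball d k).card : ℝ) + 4691 / 10000 * (ball d k).card) := by
  classical
  choose! M N hM hN hMa hM1 hM2 hMN using exists_coordinates (d := d)
  let p : Finset (Vec (d + 2) × Vec (d + 2) × Vec (d + 2)) :=
    univ.filter fun i => i.1 ≠ 0 ∧ i.2.1 ≠ 0 ∧ i.1 ≠ i.2.1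
  have hp : (p.card : ℝ) ≤ (2 ^ (d + 2)) ^ 3 := by
    have h1 : p.card ≤ (2 ^ (d + 2)) ^ 3 := by
      refine (card_le_univ p).trans (le_of_eq ?_)
      rw [Fintype.card_prod, Fintype.card_prod, ← card_univ, card_vec]
      ring
    exact_mod_cast h1
  have hB : (0 : ℝ) < (ball d k).card := by
    have := two_pow_le_two_mul_ballCard hd
    have := Nat.one_le_two_pow (n := d)
    rw [card_ball]
    exact_mod_cast (by omega : 0 < ballCard d k)
  refine (card_le_of_cover s p (fun i => twistRead (N i.1 i.2.1) i.2.2)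
    (fun _ G => PlatS k G ∧ ∑ y ∈ ball d k, cost (typeS G y)
      + ∑ y, (if typeS G y = 4 then (1 : ℝ) else 0) ≤ 4691 / 10000 * (ball d k).card) ?_ ?_
    fun i _ t ht => card_quad_le hd _ t ht).trans
    (mul_le_mul_of_nonneg_right hp (by positivity))
  · intro i hi
    obtain ⟨h1, h2, h3⟩ := (mem_filter.mp hi).2
    exact twistRead_injective (hN _ _ h1 h2 h3) _
  · intro g hg
    obtain ⟨hgp, hA⟩ := hs g hg
    obtain ⟨a, b, u, ha, hb, hab, hu⟩ := exists_cheap_flat hgp (by omega) hA ‹_› hB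
      (c := fun a b u => ∑ y ∈ ball d k, cost (typeS (twistRead (N a b) u g) y)
      + ∑ y, (if typeS (twistRead (N a b) u g) y = 4 then (1 : ℝ) else 0)) fun a b ha hb hab => by
        have h := sum_cost_twistRead_le hd (hN a b ha hb hab) (hMN a b ha hb hab)
          (hMa a b ha hb hab) g
        rwa [hM1 a b ha hb hab, hM2 a b ha hb hab] at h
    exact ⟨(a, b, u), mem_filter.mpr ⟨mem_univ _, ha, hb, hab⟩,
      hgp.twistRead (hN a b ha hb hab) (hMN a b ha hb hab) u, hu⟩

/-- The linear functional `x ↦ ⟨w, x⟩`. -/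
def ipLin {m : ℕ} (w : Vec m) : Vec m →ₗ[ZMod 2] ZMod 2 where
  toFun x := ip w x
  map_add' := ip_add_right w
  map_smul' c x := ip_smul_right c w x

/-- Every proper subspace is orthogonal to some nonzero vector. -/
lemma exists_orthogonal {m : ℕ} (H : Submodule (ZMod 2) (Vec m)) (hH : H ≠ ⊤) :
    ∃ w : Vec m, w ≠ 0 ∧ ∀ x ∈ H, ip w x = 0 := by
  obtain ⟨ψ, hψ, hle⟩ := Submodule.exists_le_ker_of_lt_top H hH.lt_top
  refine ⟨fun i => ψ (Pi.single i 1), fun h => hψ ?_, fun x hx => ?_⟩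
  · refine LinearMap.ext fun x => ?_
    rw [linear_eq_ip ψ x, h, ip_zero_left]
    rfl
  · rw [← linear_eq_ip]
    exact hle hx

/-- Restrictions of bent functions to hyperplanes are plateaued. -/
lemma plat_of_isBent {f : Vec (n + 1) → ZMod 2} (hf : IsBent f) (hn : n + 1 = 2 * k)
    {H : Submodule (ZMod 2) (Vec (n + 1))} (φ : Vec n ≃ₗ[ZMod 2] H) {g : Vec n → ZMod 2}
    (hg : ∀ x, g x = f (φ x)) : Plat k g := by
  classical
  have hfin : Module.finrank (ZMod 2) H = n := by
    rw [← φ.finrank_eq, Module.finrank_fin_fun]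
  have hH : H ≠ ⊤ := by
    rintro rfl
    rw [finrank_top, Module.finrank_fin_fun] at hfin
    omega
  obtain ⟨w, hw, hwH⟩ := exists_orthogonal H hH
  obtain ⟨z₀, hz₀⟩ : ∃ z, ip w z ≠ 0 := by
    by_contra! h
    exact hw (funext fun i => by simpa [ip, Pi.single_apply] using h (Pi.single i 1))
  have hmem : ∀ x, x ∈ H ↔ ip w x = 0 := by
    have hle : H ≤ LinearMap.ker (ipLin w) := hwH
    have hlt : Module.finrank (ZMod 2) (LinearMap.ker (ipLin w)) < n + 1 := by
      have h := Submodule.finrank_lt (s := LinearMap.ker (ipLin w))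
        fun h => hz₀ (h ▸ Submodule.mem_top : z₀ ∈ LinearMap.ker (ipLin w))
      rwa [Module.finrank_fin_fun] at h
    rw [Submodule.eq_of_le_of_finrank_le hle (by omega)]
    exact fun x => Iff.rfl
  intro y
  obtain ⟨ψ, hψ⟩ := LinearMap.exists_extend
    (ipLin y ∘ₗ φ.symm.toLinearMap)
  set z : Vec (n + 1) := fun i => ψ (Pi.single i 1) with hz
  have hzy : ∀ x, ip (φ x : Vec (n + 1)) z = ip x y := by
    intro x
    rw [ip_comm, ← linear_eq_ip]
    have := LinearMap.congr_fun hψ (φ x)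
    rw [ip_comm x y]
    simpa [ipLin] using this
  have h2 : 2 * walsh g y = walsh f z + walsh f (z + w) := by
    have h : ∀ x : Vec (n + 1), sgn (f x + ip x z) + sgn (f x + ip x (z + w))
        = if x ∈ H then 2 * sgn (f x + ip x z) else 0 := by
      intro x
      rw [ip_add_right, ← add_assoc, sgn_add _ (ip x w), ip_comm x w, hmem]
      generalize ip w x = c
      revert c
      simp only [forall_zmod_two, sgn_zero, sgn_one]
      refine ⟨?_, ?_⟩
      · simp; ring
      · simp
    rw [walsh_eq_sum f, walsh_eq_sum f, ← sum_add_distrib, sum_congr rfl fun x _ => h x,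
      ← sum_filter, walsh_eq_sum, mul_sum]
    refine sum_bij (fun x _ => (φ x : Vec (n + 1))) ?_ ?_ ?_ ?_
    · intro x _; simp
    · intro x _ x' _ h; exact φ.injective (Subtype.ext h)
    · intro x hx
      exact ⟨φ.symm ⟨x, (mem_filter.mp hx).2⟩, mem_univ _, by simp⟩
    · intro x _; rw [hg, hzy]
  have hk : (2 : ℤ) ^ ((n + 1) / 2) = 2 ^ k := by rw [hn]; congr 1; omega
  have hz1 := hf z
  have hz2 := hf (z + w)
  rw [hk] at hz1 hz2
  rcases hz1 with h3 | h3 <;> rcases hz2 with h4 | h4 <;> rw [h3, h4] at h2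
  · exact eq_two_pow_mul_sign 1 (by simp; omega)
  · exact eq_two_pow_mul_sign 0 (by simp; omega)
  · exact eq_two_pow_mul_sign 0 (by simp; omega)
  · exact eq_two_pow_mul_sign (-1) (by simp; omega)

/-- There are at most `2 ^ (3n + 2 + 3.4691 b)` plateaued functions in `n = d + 2` variables, where
`b = ballCard d k`. -/
lemma card_plat_le (hd : d + 3 = 2 * k) (hN : (65000 : ℝ) ≤ 2 ^ (d + 2))
    (s : Finset (Vec (d + 2) → ZMod 2)) (hs : ∀ g ∈ s, Plat k g) :
    (s.card : ℝ) ≤ 2 ^ (3 * ((d : ℝ) + 2) + 2 + 34691 / 10000 * (ballCard d k : ℝ)) := by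
  classical
  rw [← card_ball]
  set a : ℝ := ((ball d k).card : ℝ)
  have ha : 0 ≤ a := Nat.cast_nonneg _
  let P : (Vec (d + 2) → ZMod 2) → Prop :=
    fun g => ∀ a ≠ 0, |autoCorr g a| ≤ 3 / 5 * 2 ^ (d + 2)
  have h1 := card_unbiased_le hd hN (s.filter P) fun g hg =>
    ⟨hs g (mem_filter.mp hg).1, (mem_filter.mp hg).2⟩
  have h2 := card_biased_le hd (s.filter fun g => ¬ P g) fun g hg =>
    ⟨hs g (mem_filter.mp hg).1, by simpa [P] using (mem_filter.mp hg).2⟩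
  rw [← card_filter_add_card_filter_not (s := s) P, Nat.cast_add]
  have h3 : (2 : ℝ) ^ (3 * a + 4691 / 10000 * a) = 2 ^ (34691 / 10000 * a) := by
    congr 1; ring
  have h4 : (2 : ℝ) ^ ((2 * Real.logb 2 5 - 6 / 5) * a) ≤ 2 ^ (34691 / 10000 * a) := by
    apply Real.rpow_le_rpow_of_exponent_le (by norm_num)
    have := five_lt
    gcongr
    linarith
  have h5 : (2 : ℝ) ^ (3 * ((d : ℝ) + 2) + 2 + 34691 / 10000 * a)
      = 4 * (2 ^ (d + 2)) ^ 3 * 2 ^ (34691 / 10000 * a) := by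
    rw [Real.rpow_add (by norm_num), Real.rpow_add (by norm_num),
      show 3 * ((d : ℝ) + 2) = (((d + 2) * 3 : ℕ) : ℝ) by push_cast; ring, Real.rpow_natCast,
      Real.rpow_two, pow_mul]
    ring
  rw [h3] at h1
  rw [h5]
  have h6 := mul_le_mul_of_nonneg_left h4 (by positivity : (0 : ℝ) ≤ 2 * (2 ^ (d + 2)) ^ 3)
  have h7 : (0 : ℝ) ≤ (2 ^ (d + 2)) ^ 3 * 2 ^ (34691 / 10000 * a) := by positivity
  linarith

/-- Logarithmic form of `card_plat_le` for a class of plateaued functions. -/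
lemma logb_card_le (hd : d + 3 = 2 * k) (hN : (65000 : ℝ) ≤ 2 ^ (d + 2))
    {p : (Vec (d + 2) → ZMod 2) → Prop} (hp : ∀ g, p g → Plat k g) :
    Real.logb 2 (Nat.card {g // p g})
      ≤ 3 * ((d : ℝ) + 2) + 2 + 34691 / 10000 * (ballCard d k : ℝ) := by
  classical
  rw [Nat.card_eq_fintype_card, Fintype.card_subtype]
  have h := card_plat_le hd hN (univ.filter p) fun g hg => hp g (mem_filter.mp hg).2
  rcases (univ.filter p).card.eq_zero_or_pos with h0 | h0
  · rw [h0, Nat.cast_zero, Real.logb_zero]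
    positivity
  · exact (Real.logb_le_iff_le_rpow one_lt_two (by exact_mod_cast h0)).mpr h

/-- The linear term is negligible compared to `2 ^ d`. -/
lemma linear_le_two_pow (hd : 25 ≤ d) : 20000 * (3 * (d + 2) + 2) ≤ 2 ^ d := by
  induction d, hd using Nat.le_induction with
  | base => norm_num
  | succ d hd ih => rw [pow_succ]; omega

/-- The number of restricted bent functions, for `n = d + 2` odd. -/
lemma logNumRestrictedBent_le (hd : d + 3 = 2 * k) (hd' : 25 ≤ d) :
    logNumRestrictedBent (d + 2) ≤ 34692 / 10000 * (ballCard d k : ℝ) := by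
  classical
  have hlin : (20000 : ℝ) * (3 * (d + 2) + 2) ≤ 2 ^ d := by
    exact_mod_cast linear_le_two_pow hd'
  have hball : (2 : ℝ) ^ d ≤ 2 * ballCard d k := by
    exact_mod_cast two_pow_le_two_mul_ballCard hd
  have hd0 : (25 : ℝ) ≤ d := by exact_mod_cast hd'
  have hN : (65000 : ℝ) ≤ 2 ^ (d + 2) := by
    rw [pow_add]
    linarith
  refine (logb_card_le hd hN (p := _) fun g ⟨f, H, φ, hf, _, hg⟩ =>
    plat_of_isBent hf hd φ hg).trans ?_
  linarith

end BentCount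

/-- Asymptotic upper bound `𝒩₀(n,1) ≤ (α + 3/2)·b(n-2, (n+1)/2)·(1 + o(1))`, where
`α = 1 + (3/8)·log₂ 6`. -/
theorem logNumRestrictedBent_le_ball_bound :
    ∀ ε > (0 : ℝ), ∃ N : ℕ, ∀ n ≥ N, n % 2 = 1 →
      logNumRestrictedBent n ≤
        (1 + ε) * ((1 + (3 / 8) * Real.logb 2 6) + 3 / 2) *
          ballCard (n - 2) ((n + 1) / 2) := by
  intro ε hε
  refine ⟨27, fun n hn hodd => ?_⟩
  obtain ⟨d, rfl⟩ : ∃ d, n = d + 2 := ⟨n - 2, by omega⟩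
  rw [Nat.add_sub_cancel]
  have hd : d + 3 = 2 * ((d + 2 + 1) / 2) := by omega
  refine (BentCount.logNumRestrictedBent_le hd (by omega)).trans ?_
  gcongr
  have h6 : Real.logb 2 6 = 1 + Real.logb 2 3 := by
    rw [show (6 : ℝ) = 2 * 3 by norm_num, Real.logb_mul (by norm_num) (by norm_num),
      Real.logb_self_eq_one one_lt_two]
  have h3 := BentCount.lt_three
  rw [h6]
  nlinarith
end

section
/- For every ε > 0 there exists N such that for all odd n ≥ N, 𝒩₀(n,1) ≤ (3.47 + ε)·2^{n−3}, where 𝒩₀(n,1) is the binary logarithm of the number of n-variable 1-plateaued Boolean functions obtained by restricting (n+1)-variable bent functions to linear hyperplanes. -/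
open Finset

/-- The nontrivial sign character of `𝔽₂`. -/
def sgn (a : ZMod 2) : ℤ := (-1) ^ a.val

lemma sgn_add : ∀ a b : ZMod 2, sgn (a + b) = sgn a * sgn b := by decide

lemma sgn_mul_self : ∀ a : ZMod 2, sgn a * sgn a = 1 := by decide

lemma sgn_injective : ∀ a b : ZMod 2, sgn a = sgn b → a = b := by decide

lemma sgn_zero : sgn 0 = 1 := rfl

lemma sgn_eq_or (a : ZMod 2) : sgn a = 1 ∨ sgn a = -1 := by revert a; decide

lemma sgn_sum {ι : Type*} (s : Finset ι) (f : ι → ZMod 2) :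
    sgn (∑ i ∈ s, f i) = ∏ i ∈ s, sgn (f i) := by
  classical
  induction s using Finset.induction_on with
  | empty => rfl
  | insert a s ha ih => rw [sum_insert ha, prod_insert ha, sgn_add, ih]

section Fourier

variable {n : ℕ}

lemma ip_comm (x y : Fin n → ZMod 2) : ip x y = ip y x := dotProduct_comm x y

lemma ip_add_left (x y z : Fin n → ZMod 2) : ip (x + y) z = ip x z + ip y z :=
  add_dotProduct x y z

lemma ip_add_right (x y z : Fin n → ZMod 2) : ip x (y + z) = ip x y + ip x z :=
  dotProduct_add x y z

lemma walsh_eq (f : (Fin n → ZMod 2) → ZMod 2) (y : Fin n → ZMod 2) :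
    walsh f y = ∑ x, sgn (f x) * sgn (ip x y) :=
  sum_congr rfl fun x _ => sgn_add (f x) (ip x y)

/-- The coordinate subspace of vectors supported in `K`. -/
def cube (K : Finset (Fin n)) : Finset (Fin n → ZMod 2) :=
  Fintype.piFinset fun i => if i ∈ K then univ else {0}

lemma mem_cube {K : Finset (Fin n)} {z : Fin n → ZMod 2} :
    z ∈ cube K ↔ ∀ i, i ∉ K → z i = 0 := by
  simp only [cube, Fintype.mem_piFinset]
  refine forall_congr' fun i => ?_
  by_cases h : i ∈ K <;> simp [h]

lemma sum_cube_sgn (K : Finset (Fin n)) (x : Fin n → ZMod 2) :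
    ∑ z ∈ cube K, sgn (ip x z) = ∏ i, if i ∈ K then 1 + sgn (x i) else 1 := by
  have h : ∀ z, sgn (ip x z) = ∏ i, sgn (x i * z i) := fun z => sgn_sum _ _
  simp_rw [h]
  rw [cube, ← Finset.prod_univ_sum (fun i => if i ∈ K then univ else {0})
    (fun i (c : ZMod 2) => sgn (x i * c))]
  refine prod_congr rfl fun i _ => ?_
  by_cases hi : i ∈ K
  · simp only [hi, if_true]
    generalize x i = a
    revert a; decide
  · simp [hi, sgn_zero]

lemma two_pow_dvd_sum_cube (K : Finset (Fin n)) (x : Fin n → ZMod 2) :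
    (2 : ℤ) ^ #K ∣ ∑ z ∈ cube K, sgn (ip x z) := by
  rw [sum_cube_sgn, Finset.prod_ite_mem, univ_inter, ← Finset.prod_const]
  refine Finset.prod_dvd_prod_of_dvd _ _ fun i _ => ?_
  rcases sgn_eq_or (x i) with h | h <;> simp [h]

lemma sum_sgn_ip (x : Fin n → ZMod 2) :
    ∑ z, sgn (ip x z) = if x = 0 then 2 ^ n else 0 := by
  have h := sum_cube_sgn univ x
  have hu : cube (univ : Finset (Fin n)) = univ := by ext z; simp [mem_cube]
  rw [hu] at h
  rw [h]
  split_ifs with hx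
  · subst hx
    simp [sgn_zero]
  · obtain ⟨i, hi⟩ := Function.ne_iff.mp hx
    have hi0 : ∀ a : ZMod 2, a ≠ 0 → 1 + sgn a = 0 := by decide
    exact Finset.prod_eq_zero (mem_univ i) (hi0 _ hi)

lemma add_self_vec (x : Fin n → ZMod 2) : x + x = 0 := by
  ext i; exact CharTwo.add_self_eq_zero (x i)

lemma add_eq_zero_vec {x y : Fin n → ZMod 2} : x + y = 0 ↔ x = y := by
  constructor
  · intro h
    calc x = x + (y + y) := by rw [add_self_vec, add_zero]
      _ = y := by rw [← add_assoc, h, zero_add]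
  · rintro rfl; exact add_self_vec x

lemma sum_sgn_ip_mul (x y : Fin n → ZMod 2) :
    ∑ z, sgn (ip x z) * sgn (ip y z) = if x = y then 2 ^ n else 0 := by
  simp_rw [← sgn_add, ← ip_add_left, sum_sgn_ip, add_eq_zero_vec]

lemma walsh_inversion (g : (Fin n → ZMod 2) → ZMod 2) (x : Fin n → ZMod 2) :
    ∑ y, walsh g y * sgn (ip x y) = 2 ^ n * sgn (g x) := by
  simp_rw [walsh_eq, sum_mul, mul_assoc]
  rw [sum_comm]
  simp_rw [← mul_sum, sum_sgn_ip_mul]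
  simp [mul_comm]

lemma walsh_injective {g g' : (Fin n → ZMod 2) → ZMod 2} (h : ∀ y, walsh g y = walsh g' y) :
    g = g' := by
  funext x
  have h1 := walsh_inversion g x
  simp_rw [h, walsh_inversion g' x] at h1
  exact (sgn_injective _ _ (mul_left_cancel₀ (by positivity) h1)).symm

/-- The set of coordinates where a vector does not vanish. -/
def supp (z : Fin n → ZMod 2) : Finset (Fin n) := univ.filter fun i => z i ≠ 0

lemma mem_cube_iff_supp {K : Finset (Fin n)} {z : Fin n → ZMod 2} :
    z ∈ cube K ↔ supp z ⊆ K := by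
  rw [mem_cube]
  simp only [supp, subset_iff, mem_filter, mem_univ, true_and]
  exact forall_congr' fun i => by tauto

lemma supp_injective : Function.Injective (supp (n := n)) := by
  intro x y h
  funext i
  have hi : x i ≠ 0 ↔ y i ≠ 0 := by
    have := congrArg (i ∈ ·) h
    simpa [supp] using this
  revert hi
  generalize x i = a
  generalize y i = b
  revert a b; decide

/-- The Hamming ball of radius `r` about `0` in the coordinate subspace `cube R`. -/
def ball (R : Finset (Fin n)) (r : ℕ) : Finset (Fin n → ZMod 2) :=
  (cube R).filter fun z => #(supp z) ≤ r

lemma mem_ball {R : Finset (Fin n)} {r : ℕ} {z : Fin n → ZMod 2} :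
    z ∈ ball R r ↔ z ∈ cube R ∧ #(supp z) ≤ r := mem_filter

/-- A small integer function whose sums over large coordinate subspaces are divisible by `4`
is determined by its values on a ball. -/
lemma eq_zero_of_eq_zero_on_ball (R : Finset (Fin n)) (r : ℕ) (τ : (Fin n → ZMod 2) → ℤ)
    (hτ : ∀ z, |τ z| ≤ 3) (h4 : ∀ K ⊆ R, r < #K → 4 ∣ ∑ z ∈ cube K, τ z)
    (h0 : ∀ z ∈ ball R r, τ z = 0) : ∀ z ∈ cube R, τ z = 0 := by
  suffices h : ∀ j, ∀ z ∈ cube R, #(supp z) = j → τ z = 0 from fun z hz => h _ z hz rfl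
  intro j
  induction j using Nat.strong_induction_on with
  | _ j ih =>
    intro z hz hj
    rcases le_or_gt (#(supp z)) r with hr | hr
    · exact h0 z (mem_ball.2 ⟨hz, hr⟩)
    have hzs : z ∈ cube (supp z) := mem_cube_iff_supp.2 subset_rfl
    have hd := h4 (supp z) (mem_cube_iff_supp.1 hz) hr
    rw [Finset.sum_eq_single_of_mem z hzs] at hd
    · have := hτ z
      rw [abs_le] at this
      omega
    · intro z' hz' hne
      have hss : supp z' ⊂ supp z :=
        (mem_cube_iff_supp.1 hz').ssubset_of_ne fun h => hne (supp_injective h)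
      exact ih _ (hj ▸ card_lt_card hss) z'
        (mem_cube_iff_supp.2 (hss.subset.trans (mem_cube_iff_supp.1 hz))) rfl

end Fourier

section Plateaued

/-- The normalised Walsh spectrum of a function of `2 * m + 3` variables. -/
def spec {n : ℕ} (m : ℕ) (g : (Fin n → ZMod 2) → ZMod 2) (y : Fin n → ZMod 2) : ℤ :=
  walsh g y / 2 ^ (m + 2)

/-- The Walsh coefficients of `g` are all `0` or `±2 ^ (m + 2)`. -/
def IsPlat {n : ℕ} (m : ℕ) (g : (Fin n → ZMod 2) → ZMod 2) : Prop :=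
  ∀ y, walsh g y = 0 ∨ walsh g y = 2 ^ (m + 2) ∨ walsh g y = -2 ^ (m + 2)

lemma spec_eq_or {n m : ℕ} {g : (Fin n → ZMod 2) → ZMod 2} (hg : IsPlat m g)
    (y : Fin n → ZMod 2) : spec m g y = 0 ∨ spec m g y = 1 ∨ spec m g y = -1 := by
  have h2 : (2 : ℤ) ^ (m + 2) ≠ 0 := by positivity
  rcases hg y with h | h | h
  · left; simp [spec, h]
  · right; left; rw [spec, h, Int.ediv_self h2]
  · right; right; rw [spec, h, Int.neg_ediv_of_dvd dvd_rfl, Int.ediv_self h2]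

lemma walsh_eq_spec {n m : ℕ} {g : (Fin n → ZMod 2) → ZMod 2} (hg : IsPlat m g)
    (y : Fin n → ZMod 2) : walsh g y = 2 ^ (m + 2) * spec m g y := by
  refine (Int.mul_ediv_cancel' ?_).symm
  rcases hg y with h | h | h <;> simp [h]

variable {m : ℕ} {g g' : (Fin (2 * m + 3) → ZMod 2) → ZMod 2}

lemma four_dvd_sum_cube (hg : IsPlat m g) (p : Fin (2 * m + 3) → ZMod 2)
    (K : Finset (Fin (2 * m + 3))) (hK : m + 2 < #K) :
    4 ∣ ∑ z ∈ cube K, sgn (g (p + z)) := by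
  have h2 : (2 : ℤ) ^ (2 * m + 3) ≠ 0 := by positivity
  have key : (2 : ℤ) ^ (2 * m + 3) * ∑ z ∈ cube K, sgn (g (p + z)) =
      ∑ y, walsh g y * sgn (ip p y) * ∑ z ∈ cube K, sgn (ip y z) := by
    simp_rw [mul_sum, ← walsh_inversion]
    rw [sum_comm]
    refine sum_congr rfl fun y _ => sum_congr rfl fun z _ => ?_
    rw [ip_add_left, sgn_add, ip_comm z y]; ring
  refine (mul_dvd_mul_iff_left h2).1 ?_
  rw [key]
  refine Finset.dvd_sum fun y _ => ?_
  have h1 : (2 : ℤ) ^ (m + 2) ∣ walsh g y * sgn (ip p y) :=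
    Dvd.dvd.mul_right ⟨_, walsh_eq_spec hg y⟩ _
  refine dvd_trans ?_ (mul_dvd_mul h1 (two_pow_dvd_sum_cube K y))
  rw [← pow_add, show (4 : ℤ) = 2 ^ 2 by norm_num, ← pow_add]
  exact pow_dvd_pow _ (by omega)

/-- Plateaued functions which agree on a ball in a coordinate flat agree on the whole flat. -/
lemma eqOn_flat_of_eqOn_ball (hg : IsPlat m g) (hg' : IsPlat m g')
    (R : Finset (Fin (2 * m + 3))) (p : Fin (2 * m + 3) → ZMod 2)
    (h : ∀ z ∈ ball R (m + 2), g (p + z) = g' (p + z)) :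
    ∀ z ∈ cube R, g (p + z) = g' (p + z) := by
  intro z hz
  refine sgn_injective _ _ (sub_eq_zero.1 ?_)
  refine eq_zero_of_eq_zero_on_ball R (m + 2) (fun z => sgn (g (p + z)) - sgn (g' (p + z)))
    ?_ ?_ ?_ z hz
  · intro z
    rcases sgn_eq_or (g (p + z)) with h | h <;> rcases sgn_eq_or (g' (p + z)) with h' | h' <;>
      simp [h, h']
  · intro K _ hK
    rw [sum_sub_distrib]
    exact dvd_sub (four_dvd_sum_cube hg p K hK) (four_dvd_sum_cube hg' p K hK)
  · intro z hz
    simp [h z hz]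

lemma spec_sub_eq_sum (hg : IsPlat m g) (hg' : IsPlat m g') {R : Finset (Fin (2 * m + 3))}
    (h : ∀ x, x ∉ cube R → g x = g' x) (y : Fin (2 * m + 3) → ZMod 2) :
    2 ^ (m + 2) * (spec m g y - spec m g' y) =
      ∑ x ∈ cube R, (sgn (g x) - sgn (g' x)) * sgn (ip x y) := by
  rw [mul_sub, ← walsh_eq_spec hg, ← walsh_eq_spec hg', walsh_eq, walsh_eq, ← sum_sub_distrib]
  symm
  refine (sum_subset (subset_univ _) fun x _ hx => ?_).trans
    (sum_congr rfl fun x _ => sub_mul _ _ _)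
  rw [h x hx]; ring

/-- If two plateaued functions differ only on `cube R`, the difference of their spectra is
invariant under changing coordinates outside `R`. -/
lemma spec_sub_congr (hg : IsPlat m g) (hg' : IsPlat m g') {R : Finset (Fin (2 * m + 3))}
    (h : ∀ x, x ∉ cube R → g x = g' x) {y z : Fin (2 * m + 3) → ZMod 2}
    (hyz : ∀ i ∈ R, y i = z i) :
    spec m g y - spec m g' y = spec m g z - spec m g' z := by
  have h2 : (2 : ℤ) ^ (m + 2) ≠ 0 := by positivity
  refine mul_left_cancel₀ h2 ?_
  rw [spec_sub_eq_sum hg hg' h, spec_sub_eq_sum hg hg' h]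
  refine sum_congr rfl fun x hx => ?_
  have : ip x y = ip x z := by
    refine sum_congr rfl fun i _ => ?_
    by_cases hi : i ∈ R
    · rw [hyz i hi]
    · rw [mem_cube.1 hx i hi, zero_mul, zero_mul]
  rw [this]

/-- A plateaued function is determined by its values outside `cube R` together with its
spectrum on a ball in `cube R`. -/
lemma eq_of_eq_compl_cube_of_spec_eq_on_ball (hg : IsPlat m g) (hg' : IsPlat m g')
    {R : Finset (Fin (2 * m + 3))} (h : ∀ x, x ∉ cube R → g x = g' x)
    (hs : ∀ z ∈ ball R (m + 2), spec m g z = spec m g' z) : g = g' := by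
  have hz : ∀ z ∈ cube R, spec m g z - spec m g' z = 0 := by
    refine eq_zero_of_eq_zero_on_ball R (m + 2) _ ?_ ?_ fun z hz => sub_eq_zero.2 (hs z hz)
    · intro z
      rcases spec_eq_or hg z with h | h | h <;> rcases spec_eq_or hg' z with h' | h' | h' <;>
        simp [h, h']
    · intro K _ hK
      have h2 : (2 : ℤ) ^ (m + 2) ≠ 0 := by positivity
      refine (mul_dvd_mul_iff_left h2).1 ?_
      simp_rw [mul_sum, spec_sub_eq_sum hg hg' h]
      rw [sum_comm]
      refine Finset.dvd_sum fun x _ => ?_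
      rw [← mul_sum]
      have h1 : (2 : ℤ) ∣ sgn (g x) - sgn (g' x) := by
        generalize g x = a
        generalize g' x = b
        revert a b; decide
      refine dvd_trans ?_ (mul_dvd_mul h1 (two_pow_dvd_sum_cube K x))
      rw [← pow_succ', show (4 : ℤ) = 2 ^ 2 by norm_num, ← pow_add]
      exact pow_dvd_pow _ (by omega)
  refine walsh_injective fun y => ?_
  rw [walsh_eq_spec hg, walsh_eq_spec hg']
  congr 1
  have := hz (fun i => if i ∈ R then y i else 0) (mem_cube.2 fun i hi => if_neg hi)
  rw [← sub_eq_zero, ← this]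
  exact spec_sub_congr hg hg' h fun i hi => (if_pos hi).symm

end Plateaued

section Weights

/-- Model probability, in sixteenths, of a spectral fibre with the given entries. -/
def fibWeight (a b c d : ℤ) : ℤ :=
  if (0 ≤ a ∧ 0 ≤ b ∧ 0 ≤ c ∧ 0 ≤ d) ∨ (a ≤ 0 ∧ b ≤ 0 ∧ c ≤ 0 ∧ d ≤ 0) then
    if |a| + |b| + |c| + |d| = 0 then 14 else
    if |a| + |b| + |c| + |d| = 1 then 12 else
    if |a| + |b| + |c| + |d| = 2 then 8 else
    if |a| + |b| + |c| + |d| = 3 then 4 else 1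
  else 16

/-- Code length, in hundredths of a bit, of a spectral fibre with the given entries. -/
def fibCost (a b c d : ℤ) : ℤ :=
  if (0 ≤ a ∧ 0 ≤ b ∧ 0 ≤ c ∧ 0 ≤ d) ∨ (a ≤ 0 ∧ b ≤ 0 ∧ c ≤ 0 ∧ d ≤ 0) then
    if |a| + |b| + |c| + |d| = 0 then 20 else
    if |a| + |b| + |c| + |d| = 1 then 42 else
    if |a| + |b| + |c| + |d| = 2 then 100 else
    if |a| + |b| + |c| + |d| = 3 then 200 else 400
  else 0

/-- The values of a normalised spectrum. -/
def trits : Finset ℤ := {0, 1, -1}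

lemma sum_fibWeight_le : ∀ a ∈ trits, ∀ b ∈ trits, ∀ c ∈ trits, ∀ d ∈ trits,
    ∑ t ∈ Icc (-2 : ℤ) 2, (if a + t ∈ trits ∧ b + t ∈ trits ∧ c + t ∈ trits ∧ d + t ∈ trits
      then fibWeight (a + t) (b + t) (c + t) (d + t) else 0) ≤ 16 := by
  decide +kernel

lemma sum_fibCost_le : ∀ a ∈ trits, ∀ b ∈ trits, ∀ c ∈ trits, ∀ d ∈ trits,
    fibCost a b c d + fibCost a (-b) c (-d) + fibCost a b (-c) (-d) + fibCost a (-b) (-c) d ≤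
      80 + 88 * (a ^ 2 + b ^ 2 + c ^ 2 + d ^ 2)
        - 56 * (a ^ 2 * b ^ 2 + a ^ 2 * c ^ 2 + a ^ 2 * d ^ 2 + b ^ 2 * c ^ 2 + b ^ 2 * d ^ 2
          + c ^ 2 * d ^ 2)
        + 28 * (a ^ 2 * b ^ 2 * c ^ 2 + a ^ 2 * b ^ 2 * d ^ 2 + a ^ 2 * c ^ 2 * d ^ 2
          + b ^ 2 * c ^ 2 * d ^ 2) + 200 * (a * b * c * d) := by
  decide +kernel

lemma fibCost_nonneg (a b c d : ℤ) : 0 ≤ fibCost a b c d := by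
  unfold fibCost; split_ifs <;> norm_num

lemma fibCost_neg (a b c d : ℤ) : fibCost (-a) (-b) (-c) (-d) = fibCost a b c d := by
  unfold fibCost
  simp only [abs_neg, Left.nonneg_neg_iff, Left.neg_nonpos_iff]
  simp only [or_comm]

lemma two_rpow_neg_le {c q : ℝ} (N : ℕ) (M : ℕ) (hN : 0 < N) (hq : 0 < q)
    (hc : c * N = M) (hpow : 1 ≤ q ^ N * 2 ^ M) : (2 : ℝ) ^ (-c) ≤ q := by
  have hN' : (0 : ℝ) < N := by exact_mod_cast hN
  rw [← pow_le_pow_iff_left₀ (by positivity) hq.le hN.ne', ← Real.rpow_mul_natCast (by norm_num),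
    neg_mul, hc, Real.rpow_neg (by norm_num), Real.rpow_natCast]
  exact (inv_le_iff_one_le_mul₀ (by positivity)).2 hpow

lemma two_rpow_neg_fibCost_le (a b c d : ℤ) :
    (2 : ℝ) ^ (-((fibCost a b c d : ℝ) / 100)) ≤ (fibWeight a b c d : ℝ) / 16 := by
  unfold fibCost fibWeight
  split_ifs
  · exact two_rpow_neg_le 5 1 (by norm_num) (by norm_num) (by norm_num) (by norm_num)
  · exact two_rpow_neg_le 50 21 (by norm_num) (by norm_num) (by norm_num) (by norm_num)
  · exact two_rpow_neg_le 1 1 (by norm_num) (by norm_num) (by norm_num) (by norm_num)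
  · exact two_rpow_neg_le 1 2 (by norm_num) (by norm_num) (by norm_num) (by norm_num)
  · exact two_rpow_neg_le 1 4 (by norm_num) (by norm_num) (by norm_num) (by norm_num)
  · norm_num

end Weights

section Counting

variable {m : ℕ}

lemma spec_mem_trits {n m : ℕ} {g : (Fin n → ZMod 2) → ZMod 2} (hg : IsPlat m g)
    (y : Fin n → ZMod 2) : spec m g y ∈ trits := by
  have := spec_eq_or hg y
  simpa [trits] using this

/-- Code length of the spectral fibre of `g` over `z` in the directions `i₀`, `i₁`. -/
def specCost {n : ℕ} (m : ℕ) (g : (Fin n → ZMod 2) → ZMod 2) (i₀ i₁ : Fin n)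
    (z : Fin n → ZMod 2) : ℤ :=
  fibCost (spec m g z) (spec m g (z + Pi.single i₀ 1)) (spec m g (z + Pi.single i₁ 1))
    (spec m g (z + (Pi.single i₀ 1 + Pi.single i₁ 1)))

/-- Kraft's inequality for product codes: if the words `Φ g` are distinct and their code lengths
`∑ z, L g z` are at most `B`, there are at most `2 ^ B` of them. -/
lemma card_le_two_rpow_of_kraft {α β ι : Type*} [Fintype ι] [DecidableEq ι] [DecidableEq β]
    (A : Finset α) (Φ : α → ι → β) (T : Finset β) (Q : ι → β → ℝ) (L : α → ι → ℝ) (B : ℝ)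
    (hQ0 : ∀ z t, 0 ≤ Q z t) (hQ1 : ∀ z, ∑ t ∈ T, Q z t ≤ 1) (hinj : Set.InjOn Φ A)
    (hmem : ∀ g ∈ A, ∀ z, Φ g z ∈ T) (hL : ∀ g ∈ A, ∀ z, (2 : ℝ) ^ (-L g z) ≤ Q z (Φ g z))
    (hB : ∀ g ∈ A, ∑ z, L g z ≤ B) : (#A : ℝ) ≤ 2 ^ B := by
  have hsum : ∑ g ∈ A, ∏ z, Q z (Φ g z) ≤ 1 := by
    calc ∑ g ∈ A, ∏ z, Q z (Φ g z)
        = ∑ τ ∈ A.image Φ, ∏ z, Q z (τ z) :=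
          (sum_image (f := fun τ => ∏ z, Q z (τ z)) hinj).symm
      _ ≤ ∑ τ ∈ Fintype.piFinset fun _ : ι => T, ∏ z, Q z (τ z) :=
        sum_le_sum_of_subset_of_nonneg
          (image_subset_iff.2 fun g hg => Fintype.mem_piFinset.2 (hmem g hg))
          fun τ _ _ => prod_nonneg fun z _ => hQ0 z (τ z)
      _ = ∏ z, ∑ t ∈ T, Q z t := (Finset.prod_univ_sum _ _).symm
      _ ≤ 1 := prod_le_one (fun z _ => sum_nonneg fun t _ => hQ0 z t) fun z _ => hQ1 z
  have hterm : ∀ g ∈ A, (2 : ℝ) ^ (-B) ≤ ∏ z, Q z (Φ g z) := by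
    intro g hg
    refine le_trans ?_ (prod_le_prod (fun z _ => by positivity) fun z _ => hL g hg z)
    rw [← Real.rpow_sum_of_pos (by norm_num), sum_neg_distrib]
    exact Real.rpow_le_rpow_of_exponent_le (by norm_num) (neg_le_neg (hB g hg))
  have := (card_nsmul_le_sum A _ _ hterm).trans hsum
  rwa [nsmul_eq_mul, Real.rpow_neg (by norm_num), ← div_eq_mul_inv,
    div_le_one (by positivity)] at this

/-- There are few plateaued functions of bounded spectral cost with prescribed values on three
quarters of the space. -/
lemma card_le_of_eq_compl_cube (i₀ i₁ : Fin (2 * m + 3))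
    (A : Finset ((Fin (2 * m + 3) → ZMod 2) → ZMod 2)) (B : ℝ)
    (hA : ∀ g ∈ A, IsPlat m g)
    (hcost : ∀ g ∈ A, ((∑ z ∈ ball {i₀, i₁}ᶜ (m + 2), specCost m g i₀ i₁ z : ℤ) : ℝ) ≤ 100 * B)
    (hagree : ∀ g ∈ A, ∀ g' ∈ A, ∀ x, x ∉ cube {i₀, i₁}ᶜ → g x = g' x) :
    (#A : ℝ) ≤ 2 ^ B := by
  rcases A.eq_empty_or_nonempty with rfl | ⟨g₀, hg₀⟩
  · simp only [card_empty, Nat.cast_zero]; positivity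
  set I := ball ({i₀, i₁}ᶜ : Finset (Fin (2 * m + 3))) (m + 2) with hI
  let a : (Fin (2 * m + 3) → ZMod 2) → ℤ := spec m g₀
  let e₀ : Fin (2 * m + 3) → ZMod 2 := Pi.single i₀ 1
  let e₁ : Fin (2 * m + 3) → ZMod 2 := Pi.single i₁ 1
  let Q : I → ℤ → ℤ := fun z t =>
    if a z + t ∈ trits ∧ a (z + e₀) + t ∈ trits ∧ a (z + e₁) + t ∈ trits ∧
      a (z + (e₀ + e₁)) + t ∈ trits
    then fibWeight (a z + t) (a (z + e₀) + t) (a (z + e₁) + t) (a (z + (e₀ + e₁)) + t) else 0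
  let Φ : ((Fin (2 * m + 3) → ZMod 2) → ZMod 2) → I → ℤ := fun g z => spec m g z - spec m g₀ z
  have hQ0 : ∀ z t, 0 ≤ Q z t := by
    intro z t
    simp only [Q, fibWeight]
    split_ifs <;> norm_num
  have hQ1 : ∀ z, ∑ t ∈ Icc (-2 : ℤ) 2, ((Q z t : ℝ) / 16) ≤ 1 := by
    intro z
    rw [← sum_div, div_le_one (by norm_num)]
    have := sum_fibWeight_le _ (spec_mem_trits (hA _ hg₀) z)
      _ (spec_mem_trits (hA _ hg₀) (z + e₀)) _ (spec_mem_trits (hA _ hg₀) (z + e₁))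
      _ (spec_mem_trits (hA _ hg₀) (z + (e₀ + e₁)))
    exact_mod_cast this
  have hΦQ : ∀ g ∈ A, ∀ z : I, (2 : ℝ) ^ (-((specCost m g i₀ i₁ z : ℝ) / 100)) ≤
      (Q z (Φ g z) : ℝ) / 16 := by
    intro g hg z
    have hinv : ∀ s : Fin (2 * m + 3) → ZMod 2, (∀ i ∈ ({i₀, i₁}ᶜ : Finset _), s i = 0) →
        a (z + s) + Φ g z = spec m g (z + s) := by
      intro s hs
      have := spec_sub_congr (hA g hg) (hA g₀ hg₀) (hagree g hg g₀ hg₀)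
        (y := z + s) (z := z) (fun i hi => by simp [hs i hi])
      simp only [a, Φ]; linarith
    have h0 : a z + Φ g z = spec m g z := by simp [a, Φ]
    have he₀ : ∀ i ∈ ({i₀, i₁}ᶜ : Finset _), e₀ i = 0 := by
      intro i hi
      simp only [mem_compl, mem_insert, mem_singleton, not_or] at hi
      simp [e₀, hi.1]
    have he₁ : ∀ i ∈ ({i₀, i₁}ᶜ : Finset _), e₁ i = 0 := by
      intro i hi
      simp only [mem_compl, mem_insert, mem_singleton, not_or] at hi
      simp [e₁, hi.2]
    have hQ : Q z (Φ g z) = fibWeight (spec m g z) (spec m g (z + e₀)) (spec m g (z + e₁))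
        (spec m g (z + (e₀ + e₁))) := by
      simp only [Q]
      rw [h0, hinv e₀ he₀, hinv e₁ he₁,
        hinv (e₀ + e₁) (fun i hi => by simp [he₀ i hi, he₁ i hi]), if_pos]
      exact ⟨spec_mem_trits (hA g hg) _, spec_mem_trits (hA g hg) _,
        spec_mem_trits (hA g hg) _, spec_mem_trits (hA g hg) _⟩
    rw [hQ]
    exact two_rpow_neg_fibCost_le _ _ _ _
  have hinj : Set.InjOn Φ A := by
    intro g hg g' hg' h
    refine eq_of_eq_compl_cube_of_spec_eq_on_ball (hA g hg) (hA g' hg')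
      (hagree g hg g' hg') fun z hz => ?_
    have := congrFun h ⟨z, hz⟩
    simpa [Φ] using this
  have hmem : ∀ g ∈ A, ∀ z, Φ g z ∈ Icc (-2 : ℤ) 2 := by
    intro g hg z
    rw [mem_Icc]
    simp only [Φ]
    rcases spec_eq_or (hA g hg) z with h | h | h <;>
      rcases spec_eq_or (hA g₀ hg₀) z with h' | h' | h' <;> simp [h, h']
  refine card_le_two_rpow_of_kraft A Φ (Icc (-2) 2) (fun z t => (Q z t : ℝ) / 16)
    (fun g z => (specCost m g i₀ i₁ z : ℝ) / 100) B (fun z t => ?_) hQ1 hinj hmem hΦQ ?_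
  · have : (0 : ℝ) ≤ Q z t := by exact_mod_cast hQ0 z t
    positivity
  · intro g hg
    rw [← sum_div, div_le_iff₀ (by norm_num), mul_comm B]
    have := hcost g hg
    rw [Finset.sum_coe_sort I (fun z => (specCost m g i₀ i₁ z : ℝ))]
    exact_mod_cast this

/-- There are few plateaued functions of bounded spectral cost. -/
lemma card_le_of_specCost_le (i₀ i₁ : Fin (2 * m + 3)) (hi : i₀ ≠ i₁)
    (A : Finset ((Fin (2 * m + 3) → ZMod 2) → ZMod 2)) (B : ℝ)
    (hA : ∀ g ∈ A, IsPlat m g)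
    (hcost : ∀ g ∈ A,
      ((∑ z ∈ ball {i₀, i₁}ᶜ (m + 2), specCost m g i₀ i₁ z : ℤ) : ℝ) ≤ 100 * B) :
    (#A : ℝ) ≤ 2 ^ (3 * (#(ball ({i₀, i₁}ᶜ : Finset (Fin (2 * m + 3))) (m + 2)) : ℝ) + B) := by
  classical
  set I := ball ({i₀, i₁}ᶜ : Finset (Fin (2 * m + 3))) (m + 2) with hI
  let e₀ : Fin (2 * m + 3) → ZMod 2 := Pi.single i₀ 1
  let e₁ : Fin (2 * m + 3) → ZMod 2 := Pi.single i₁ 1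
  let p : Fin 3 → Fin (2 * m + 3) → ZMod 2 := ![e₀, e₁, e₀ + e₁]
  let D : ((Fin (2 * m + 3) → ZMod 2) → ZMod 2) → Fin 3 × I → ZMod 2 :=
    fun g q => g (p q.1 + q.2)
  have hfib : ∀ t, (#(A.filter fun g => D g = t) : ℝ) ≤ 2 ^ B := by
    intro t
    refine card_le_of_eq_compl_cube i₀ i₁ _ B (fun g hg => hA g (mem_filter.1 hg).1)
      (fun g hg => hcost g (mem_filter.1 hg).1) fun g hg g' hg' x hx => ?_
    rw [mem_filter] at hg hg'
    have hD : D g = D g' := hg.2.trans hg'.2.symm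
    have hq : ∀ j : Fin 3, ∀ z ∈ cube ({i₀, i₁}ᶜ : Finset (Fin (2 * m + 3))),
        g (p j + z) = g' (p j + z) := fun j =>
      eqOn_flat_of_eqOn_ball (hA g hg.1) (hA g' hg'.1) _ (p j) fun z hz =>
        congrFun hD (j, ⟨z, hz⟩)
    obtain ⟨j, hj₀, hj₁⟩ : ∃ j : Fin 3, p j i₀ = x i₀ ∧ p j i₁ = x i₁ := by
      have hx' : x i₀ ≠ 0 ∨ x i₁ ≠ 0 := by
        by_contra! hcon
        refine hx (mem_cube.2 fun i hi => ?_)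
        simp only [mem_compl, mem_insert, mem_singleton, not_not] at hi
        rcases hi with rfl | rfl
        exacts [hcon.1, hcon.2]
      have hdec : ∀ a b : ZMod 2, a ≠ 0 ∨ b ≠ 0 →
          (a = 1 ∧ b = 0) ∨ (a = 0 ∧ b = 1) ∨ (a = 1 ∧ b = 1) := by decide
      rcases hdec _ _ hx' with h | h | h
      · exact ⟨0, by simp [p, e₀, h.1], by simp [p, e₀, h.2, hi.symm]⟩
      · exact ⟨1, by simp [p, e₁, h.1, hi], by simp [p, e₁, h.2]⟩
      · exact ⟨2, by simp [p, e₀, e₁, h.1, hi], by simp [p, e₀, e₁, h.2, hi.symm]⟩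
    have hz : p j + x ∈ cube ({i₀, i₁}ᶜ : Finset (Fin (2 * m + 3))) := by
      refine mem_cube.2 fun i hi => ?_
      simp only [mem_compl, mem_insert, mem_singleton, not_not] at hi
      rcases hi with rfl | rfl
      · rw [Pi.add_apply, hj₀, CharTwo.add_self_eq_zero]
      · rw [Pi.add_apply, hj₁, CharTwo.add_self_eq_zero]
    have := hq j _ hz
    rwa [← add_assoc, add_self_vec, zero_add] at this
  have hcard := card_eq_sum_card_fiberwise (f := D) (s := A) (t := univ) (by simp)
  rw [hcard]
  push_cast
  refine (sum_le_card_nsmul univ _ _ fun t _ => hfib t).trans ?_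
  rw [card_univ, Fintype.card_fun, Fintype.card_prod, Fintype.card_fin, Fintype.card_coe,
    ZMod.card, nsmul_eq_mul, Real.rpow_add (by norm_num)]
  refine mul_le_mul_of_nonneg_right (le_of_eq ?_) (by positivity)
  exact_mod_cast (Real.rpow_natCast 2 _).symm

end Counting

section Averaging

lemma sum_shift {n : ℕ} {M : Type*} [AddCommMonoid M] (f : (Fin n → ZMod 2) → M)
    (c : Fin n → ZMod 2) : ∑ x, f (x + c) = ∑ x, f x :=
  Equiv.sum_comp (Equiv.addRight c) f

lemma sum_shift_left {n : ℕ} {M : Type*} [AddCommMonoid M] (f : (Fin n → ZMod 2) → M)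
    (c : Fin n → ZMod 2) : ∑ x, f (c + x) = ∑ x, f x :=
  Equiv.sum_comp (Equiv.addLeft c) f

lemma sum_walsh_sq {n : ℕ} (g : (Fin n → ZMod 2) → ZMod 2) :
    ∑ y, walsh g y ^ 2 = (2 ^ n) ^ 2 := by
  have h : ∀ y, walsh g y ^ 2 = ∑ x, sgn (g x) * (walsh g y * sgn (ip x y)) := by
    intro y
    rw [sq]
    nth_rewrite 2 [walsh_eq]
    rw [mul_sum]
    exact sum_congr rfl fun x _ => by ring
  simp_rw [h]
  rw [sum_comm]
  simp_rw [← mul_sum, walsh_inversion]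
  have : ∀ x, sgn (g x) * (2 ^ n * sgn (g x)) = 2 ^ n := fun x => by
    rw [mul_left_comm, sgn_mul_self, mul_one]
  simp_rw [this]
  simp [sq]

lemma sum_walsh_mul_walsh_add {n : ℕ} (g : (Fin n → ZMod 2) → ZMod 2) (y : Fin n → ZMod 2) :
    ∑ b, walsh g b * walsh g (b + y) = 2 ^ n * ∑ x, sgn (ip x y) := by
  have h : ∀ b, walsh g b * walsh g (b + y) =
      ∑ x, sgn (g x) * sgn (ip x y) * (walsh g b * sgn (ip x b)) := by
    intro b
    rw [walsh_eq g (b + y), mul_sum]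
    refine sum_congr rfl fun x _ => ?_
    rw [ip_add_right, sgn_add]; ring
  simp_rw [h]
  rw [sum_comm]
  simp_rw [← mul_sum, walsh_inversion]
  rw [mul_sum]
  refine sum_congr rfl fun x _ => ?_
  linear_combination 2 ^ n * sgn (ip x y) * sgn_mul_self (g x)

/-- The fourth moment of the Walsh transform over all parallelograms. -/
lemma sum_walsh_parallelogram {n : ℕ} (g : (Fin n → ZMod 2) → ZMod 2) :
    ∑ y, ∑ a, ∑ b, walsh g y * walsh g (y + a) * walsh g (y + b) * walsh g (y + (a + b)) =
      (2 ^ n) ^ 4 := by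
  have h : ∀ y a, ∑ b, walsh g y * walsh g (y + a) * walsh g (y + b) * walsh g (y + (a + b)) =
      walsh g y * walsh g (y + a) * (2 ^ n * if a = 0 then 2 ^ n else 0) := by
    intro y a
    rw [← sum_sgn_ip a]
    simp_rw [ip_comm a, ← sum_walsh_mul_walsh_add g a, mul_assoc (walsh g y * walsh g (y + a)),
      ← mul_sum]
    congr 1
    rw [← sum_shift_left (fun b => walsh g b * walsh g (b + a)) y]
    refine sum_congr rfl fun b _ => ?_
    rw [add_comm a b, add_assoc]
  simp_rw [h]
  simp only [mul_ite, mul_zero, sum_ite_eq', mem_univ, if_true, add_zero]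
  rw [← sum_mul]
  simp_rw [← sq, sum_walsh_sq]
  ring

lemma sum_spec_sq {m : ℕ} {g : (Fin (2 * m + 3) → ZMod 2) → ZMod 2} (hg : IsPlat m g) :
    2 * ∑ y, spec m g y ^ 2 = 2 ^ (2 * m + 3) := by
  have h := sum_walsh_sq g
  simp_rw [walsh_eq_spec hg, mul_pow, ← mul_sum] at h
  have h2 : ((2 : ℤ) ^ (m + 2)) ^ 2 ≠ 0 := by positivity
  refine mul_left_cancel₀ h2 ?_
  rw [mul_left_comm, h]
  ring

lemma sum_spec_parallelogram {m : ℕ} {g : (Fin (2 * m + 3) → ZMod 2) → ZMod 2}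
    (hg : IsPlat m g) :
    4 * ∑ y, ∑ a, ∑ b, spec m g y * spec m g (y + a) * spec m g (y + b) * spec m g (y + (a + b))
      = (2 ^ (2 * m + 3)) ^ 2 := by
  have h := sum_walsh_parallelogram g
  have h1 : ∀ y a b, walsh g y * walsh g (y + a) * walsh g (y + b) * walsh g (y + (a + b)) =
      (2 ^ (m + 2)) ^ 4 * (spec m g y * spec m g (y + a) * spec m g (y + b) *
        spec m g (y + (a + b))) := by
    intro y a b
    simp_rw [walsh_eq_spec hg]; ring
  simp_rw [h1, ← mul_sum] at h
  have h2 : ((2 : ℤ) ^ (m + 2)) ^ 4 ≠ 0 := by positivity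
  refine mul_left_cancel₀ h2 ?_
  rw [mul_left_comm, h]
  ring

section Moments

variable {n : ℕ} (s : (Fin n → ZMod 2) → ℤ)

/-- Averages of elementary symmetric functions over all parallelograms. -/
lemma sum_parallelogram_symm (A B C : ℤ) :
    ∑ y, ∑ a, ∑ b, (A * (s y + s (y + a) + s (y + b) + s (y + (a + b)))
      + B * (s y * s (y + a) + s y * s (y + b) + s y * s (y + (a + b)) + s (y + a) * s (y + b)
        + s (y + a) * s (y + (a + b)) + s (y + b) * s (y + (a + b)))
      + C * (s y * s (y + a) * s (y + b) + s y * s (y + a) * s (y + (a + b))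
        + s y * s (y + b) * s (y + (a + b)) + s (y + a) * s (y + b) * s (y + (a + b)))) =
    4 * A * (2 ^ n) ^ 2 * ∑ y, s y + 6 * B * 2 ^ n * (∑ y, s y) ^ 2
      + 4 * C * (∑ y, s y) ^ 3 := by
  set S := ∑ y, s y with hS
  have hc : ((Finset.univ : Finset (Fin n → ZMod 2)).card : ℤ) = 2 ^ n := by simp
  have hb : ∀ c, ∑ b, s (c + b) = S := fun c => sum_shift_left s c
  have hab : ∀ y a, ∑ b, s (y + (a + b)) = S := fun y a => by
    simp_rw [← add_assoc]; exact hb _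
  have hpair : ∀ y a, ∑ b, s (y + b) * s (y + (a + b)) = ∑ b, s b * s (b + a) := fun y a => by
    rw [← sum_shift_left (fun b => s b * s (b + a)) y]
    refine sum_congr rfl fun b _ => ?_
    rw [add_comm a b, add_assoc]
  have hpair2 : ∑ a, ∑ b, s b * s (b + a) = S ^ 2 := by
    rw [sum_comm]
    simp_rw [← mul_sum, hb]
    rw [← sum_mul, sq]
  have hinner : ∀ y a, ∑ b, (A * (s y + s (y + a) + s (y + b) + s (y + (a + b)))
      + B * (s y * s (y + a) + s y * s (y + b) + s y * s (y + (a + b)) + s (y + a) * s (y + b)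
        + s (y + a) * s (y + (a + b)) + s (y + b) * s (y + (a + b)))
      + C * (s y * s (y + a) * s (y + b) + s y * s (y + a) * s (y + (a + b))
        + s y * s (y + b) * s (y + (a + b)) + s (y + a) * s (y + b) * s (y + (a + b)))) =
      A * (2 ^ n * s y + 2 ^ n * s (y + a) + 2 * S)
      + B * (2 ^ n * (s y * s (y + a)) + 2 * S * s y + 2 * S * s (y + a)
        + ∑ b, s b * s (b + a))
      + C * (2 * S * (s y * s (y + a)) + s y * ∑ b, s b * s (b + a)
        + s (y + a) * ∑ b, s b * s (b + a)) := by
    intro y a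
    simp only [sum_add_distrib, ← mul_sum, sum_const, nsmul_eq_mul, hc, hb, hab, hpair,
      mul_assoc]
    ring
  simp_rw [hinner]
  have hmid : ∀ y, ∑ a, (A * (2 ^ n * s y + 2 ^ n * s (y + a) + 2 * S)
      + B * (2 ^ n * (s y * s (y + a)) + 2 * S * s y + 2 * S * s (y + a)
        + ∑ b, s b * s (b + a))
      + C * (2 * S * (s y * s (y + a)) + s y * ∑ b, s b * s (b + a)
        + s (y + a) * ∑ b, s b * s (b + a))) =
      A * (2 ^ n * 2 ^ n * s y + 3 * 2 ^ n * S) + B * (3 * 2 ^ n * S * s y + 3 * S ^ 2)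
      + C * (3 * S ^ 2 * s y + ∑ a, s (y + a) * ∑ b, s b * s (b + a)) := by
    intro y
    simp only [sum_add_distrib, ← mul_sum, sum_const, nsmul_eq_mul, hc, hb, hpair2]
    ring
  have hlast : ∑ y, ∑ a, s (y + a) * ∑ b, s b * s (b + a) = S * S ^ 2 := by
    rw [sum_comm]
    simp_rw [← sum_mul, fun a => sum_shift s a, ← mul_sum, ← hS, hpair2]
  simp_rw [hmid]
  simp only [sum_add_distrib, ← mul_sum, sum_const, nsmul_eq_mul, hc, hlast, ← hS]
  ring

end Moments

/-- The total cost of the fibres of a spectrum over all cosets of a fixed plane, with signs. -/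
def planeCost {n : ℕ} (m : ℕ) (g : (Fin n → ZMod 2) → ZMod 2) (a b : Fin n → ZMod 2)
    (σ τ : ZMod 2) : ℤ :=
  ∑ y, fibCost (spec m g y) (sgn σ * spec m g (y + a)) (sgn τ * spec m g (y + b))
    (sgn (σ + τ) * spec m g (y + (a + b)))

lemma sum_planeCost_le {m : ℕ} {g : (Fin (2 * m + 3) → ZMod 2) → ZMod 2} (hg : IsPlat m g) :
    ∑ a, ∑ b, ∑ σ, ∑ τ, planeCost m g a b σ τ ≤
      186 * (2 ^ (2 * m + 3)) ^ 3 + 50 * (2 ^ (2 * m + 3)) ^ 2 := by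
  set q : ℤ := 2 ^ (2 * m + 3) with hq
  set w := spec m g with hw
  have hpt : ∀ a b, ∑ σ, ∑ τ, planeCost m g a b σ τ ≤ ∑ y, (80
      + (88 * (w y ^ 2 + w (y + a) ^ 2 + w (y + b) ^ 2 + w (y + (a + b)) ^ 2)
      + (-56) * (w y ^ 2 * w (y + a) ^ 2 + w y ^ 2 * w (y + b) ^ 2
        + w y ^ 2 * w (y + (a + b)) ^ 2 + w (y + a) ^ 2 * w (y + b) ^ 2
        + w (y + a) ^ 2 * w (y + (a + b)) ^ 2 + w (y + b) ^ 2 * w (y + (a + b)) ^ 2)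
      + 28 * (w y ^ 2 * w (y + a) ^ 2 * w (y + b) ^ 2
        + w y ^ 2 * w (y + a) ^ 2 * w (y + (a + b)) ^ 2
        + w y ^ 2 * w (y + b) ^ 2 * w (y + (a + b)) ^ 2
        + w (y + a) ^ 2 * w (y + b) ^ 2 * w (y + (a + b)) ^ 2))
      + 200 * (w y * w (y + a) * w (y + b) * w (y + (a + b)))) := by
    intro a b
    have hz : ∀ F : ZMod 2 → ℤ, ∑ σ, F σ = F 0 + F 1 := fun F => Fin.sum_univ_two F
    have h01 : sgn 0 = 1 ∧ sgn 1 = -1 ∧ sgn (0 + 0) = 1 ∧ sgn (0 + 1) = -1 ∧ sgn (1 + 0) = -1 ∧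
      sgn (1 + 1) = 1 := by decide
    simp only [hz, planeCost, h01, ← sum_add_distrib, one_mul, neg_one_mul]
    refine sum_le_sum fun y _ => ?_
    have := sum_fibCost_le _ (spec_mem_trits hg y) _ (spec_mem_trits hg (y + a))
      _ (spec_mem_trits hg (y + b)) _ (spec_mem_trits hg (y + (a + b)))
    linarith
  refine (sum_le_sum fun a _ => sum_le_sum fun b _ => hpt a b).trans (le_of_eq ?_)
  have hswap : ∀ F : (Fin (2 * m + 3) → ZMod 2) → (Fin (2 * m + 3) → ZMod 2) →
      (Fin (2 * m + 3) → ZMod 2) → ℤ,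
      ∑ a, ∑ b, ∑ y, F a b y = ∑ y, ∑ a, ∑ b, F a b y := by
    intro F
    rw [sum_comm (s := univ) (t := univ) (f := fun y a => ∑ b, F a b y)]
    exact sum_congr rfl fun a _ => sum_comm
  rw [hswap]
  have h2 := sum_parallelogram_symm (fun y => w y ^ 2) 88 (-56) 28
  have h4 := sum_spec_parallelogram hg
  have hs := sum_spec_sq hg
  rw [← hw, ← hq] at h4 hs
  rw [← hq] at h2
  have hc : ((Finset.univ : Finset (Fin (2 * m + 3) → ZMod 2)).card : ℤ) = q := by simp [hq]
  have hsplit : ∀ F G : (Fin (2 * m + 3) → ZMod 2) → (Fin (2 * m + 3) → ZMod 2) →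
      (Fin (2 * m + 3) → ZMod 2) → ℤ, ∑ y, ∑ a, ∑ b, (80 + F y a b + 200 * G y a b) =
      80 * q ^ 3 + ∑ y, ∑ a, ∑ b, F y a b + 200 * ∑ y, ∑ a, ∑ b, G y a b := by
    intro F G
    simp only [sum_add_distrib, ← mul_sum, sum_const, nsmul_eq_mul, hc]
    ring
  refine (hsplit _ _).trans ?_
  rw [h2, ← hs]
  rw [← hs] at h4
  linear_combination 50 * h4

end Averaging

section NormalForm

lemma planeCost_nonneg {n : ℕ} (m : ℕ) (g : (Fin n → ZMod 2) → ZMod 2) (a b : Fin n → ZMod 2)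
    (σ τ : ZMod 2) : 0 ≤ planeCost m g a b σ τ :=
  sum_nonneg fun _ _ => fibCost_nonneg _ _ _ _

lemma exists_planeCost_le {m : ℕ} (hm : 4 ≤ m) {g : (Fin (2 * m + 3) → ZMod 2) → ZMod 2}
    (hg : IsPlat m g) : ∃ a b σ τ, a ≠ 0 ∧ b ≠ 0 ∧ a ≠ b ∧
      10 * planeCost m g a b σ τ ≤ 468 * 2 ^ (2 * m + 3) := by
  by_contra! hcon
  have hle := sum_planeCost_le hg
  set q : ℤ := 2 ^ (2 * m + 3) with hq
  have hq_large : 2 ^ 11 ≤ q := pow_le_pow_right₀ (by norm_num) (by omega)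
  have hpt : ∀ a b σ τ, 468 * q * (1 - (if a = 0 then 1 else 0) - (if b = 0 then 1 else 0)
      - (if a = b then 1 else 0)) ≤ 10 * planeCost m g a b σ τ := by
    intro a b σ τ
    have h0 := planeCost_nonneg m g a b σ τ
    have h1 := hcon a b σ τ
    by_cases ha : a = 0
    · rw [if_pos ha]; split_ifs <;> nlinarith
    by_cases hb : b = 0
    · rw [if_pos hb]; split_ifs <;> nlinarith
    by_cases hab : a = b
    · rw [if_pos hab]; split_ifs; nlinarith
    rw [if_neg ha, if_neg hb, if_neg hab]
    linarith [h1 ha hb hab]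
  have hsum := sum_le_sum fun a (_ : a ∈ univ) => sum_le_sum fun b (_ : b ∈ univ) =>
    sum_le_sum fun σ (_ : σ ∈ univ) => sum_le_sum fun τ (_ : τ ∈ univ) => hpt a b σ τ
  have hc : (Fintype.card (Fin (2 * m + 3) → ZMod 2) : ℤ) = q := by simp [hq]
  simp only [← mul_sum, sum_sub_distrib, sum_const, nsmul_eq_mul, card_univ, hc, ZMod.card,
    sum_ite_eq, sum_ite_eq', mem_univ, if_true] at hsum
  push_cast at hsum
  nlinarith [mul_nonneg (sub_nonneg.2 hq_large) (sq_nonneg q), sq_nonneg q]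

lemma exists_basis_of_ne {m : ℕ} {a b : Fin (2 * m + 3) → ZMod 2} (ha : a ≠ 0) (hb : b ≠ 0)
    (hab : a ≠ b) :
    ∃ B : Module.Basis (Fin (2 * m + 3)) (ZMod 2) (Fin (2 * m + 3) → ZMod 2),
      B 0 = a ∧ B 1 = b := by
  have hli : LinearIndependent (ZMod 2) ![a, b] := by
    rw [LinearIndependent.pair_iff]
    have h2 : ∀ s : ZMod 2, s = 0 ∨ s = 1 := by decide
    intro s t h
    rcases h2 s with rfl | rfl <;> rcases h2 t with rfl | rfl <;>
      simp_all [add_eq_zero_vec]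
  let C := Module.Basis.sumExtend hli
  have : Finite (Fin 2 ⊕ Module.Basis.sumExtendIndex hli) := Module.Finite.finite_basis C
  have : Finite (Module.Basis.sumExtendIndex hli) :=
    Finite.of_injective (Sum.inr : _ → Fin 2 ⊕ Module.Basis.sumExtendIndex hli) Sum.inr_injective
  have hcard : Nat.card (Module.Basis.sumExtendIndex hli) = 2 * m + 1 := by
    have h := Module.finrank_eq_nat_card_basis C
    rw [Nat.card_sum, Module.finrank_fin_fun, Nat.card_eq_fintype_card, Fintype.card_fin] at h
    omega
  let E : Fin 2 ⊕ Module.Basis.sumExtendIndex hli ≃ Fin (2 * m + 3) :=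
    ((Equiv.sumCongr (Equiv.refl _) (Finite.equivFinOfCardEq hcard)).trans finSumFinEquiv).trans
      (finCongr (by omega))
  have hC : ∀ i, C (Sum.inl i) = ![a, b] i := fun i => by
    simp only [C, Module.Basis.sumExtend, Module.Basis.reindex_apply]
    rw [Module.Basis.extend_apply_self]
    rfl
  refine ⟨C.reindex E, ?_, ?_⟩
  · have : E (Sum.inl 0) = 0 := rfl
    rw [← this, Module.Basis.reindex_apply, Equiv.symm_apply_apply, hC]; rfl
  · have : E (Sum.inl 1) = 1 := by
      ext; simp [E]
    rw [← this, Module.Basis.reindex_apply, Equiv.symm_apply_apply, hC]; rfl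

/-- Inner products of `x` with the vectors of a family. -/
def coords {n : ℕ} (B : Fin n → Fin n → ZMod 2) (x : Fin n → ZMod 2) : Fin n → ZMod 2 :=
  fun i => ip x (B i)

lemma ip_coords {n : ℕ} (B : Module.Basis (Fin n) (ZMod 2) (Fin n → ZMod 2))
    (x ζ : Fin n → ZMod 2) : ip (coords B x) ζ = ip x (B.equivFun.symm ζ) := by
  rw [Module.Basis.equivFun_symm_apply]
  change ∑ i, ip x (B i) * ζ i = x ⬝ᵥ ∑ i, ζ i • B i
  rw [dotProduct_sum]
  refine sum_congr rfl fun i _ => ?_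
  rw [dotProduct_smul, smul_eq_mul, mul_comm]
  rfl

lemma coords_bijective {n : ℕ} (B : Module.Basis (Fin n) (ZMod 2) (Fin n → ZMod 2)) :
    Function.Bijective (coords B) := by
  refine Finite.injective_iff_bijective.1 fun x y h => ?_
  refine dotProduct_eq _ _ fun v => ?_
  have h1 := ip_coords B x (B.equivFun v)
  have h2 := ip_coords B y (B.equivFun v)
  rw [LinearEquiv.symm_apply_apply] at h1 h2
  change ip x v = ip y v
  rw [← h1, ← h2, h]

lemma walsh_coords {n : ℕ} (B : Module.Basis (Fin n) (ZMod 2) (Fin n → ZMod 2))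
    {g g₀ : (Fin n → ZMod 2) → ZMod 2} {u e : Fin n → ZMod 2}
    (h : ∀ x, g₀ (coords B x) = g (x + u) + ip e x) (ζ : Fin n → ZMod 2) :
    walsh g₀ ζ = sgn (ip u (e + B.equivFun.symm ζ)) * walsh g (e + B.equivFun.symm ζ) := by
  rw [walsh_eq, walsh_eq, ← (coords_bijective B).sum_comp, mul_sum, ← sum_shift _ u]
  refine sum_congr rfl fun x _ => ?_
  rw [h, ip_coords, add_assoc, add_self_vec, add_zero]
  simp only [sgn_add, ip_comm e, ip_add_left, ip_add_right]
  ring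

lemma spec_coords {n m : ℕ} (B : Module.Basis (Fin n) (ZMod 2) (Fin n → ZMod 2))
    {g g₀ : (Fin n → ZMod 2) → ZMod 2} (hg : IsPlat m g) {u e : Fin n → ZMod 2}
    (h : ∀ x, g₀ (coords B x) = g (x + u) + ip e x) :
    IsPlat m g₀ ∧ ∀ ζ, spec m g₀ ζ =
      sgn (ip u (e + B.equivFun.symm ζ)) * spec m g (e + B.equivFun.symm ζ) := by
  have hp : IsPlat m g₀ := by
    intro ζ
    rw [walsh_coords B h]
    generalize e + B.equivFun.symm ζ = y
    rcases sgn_eq_or (ip u y) with hs | hs <;>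
      rcases hg y with hw | hw | hw <;> simp [hs, hw]
  refine ⟨hp, fun ζ => ?_⟩
  have h2 : (2 : ℤ) ^ (m + 2) ≠ 0 := by positivity
  refine mul_left_cancel₀ h2 ?_
  rw [← walsh_eq_spec hp, walsh_coords B h, walsh_eq_spec hg]
  ring

lemma exists_translate_sum_le {n : ℕ} (I : Finset (Fin n → ZMod 2))
    (T : (Fin n → ZMod 2) → (Fin n → ZMod 2)) (F : (Fin n → ZMod 2) → ℤ) :
    ∃ e, 2 ^ n * ∑ z ∈ I, F (e + T z) ≤ #I * ∑ y, F y := by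
  by_contra! hcon
  have hlt := sum_lt_sum_of_nonempty (univ_nonempty (α := Fin n → ZMod 2)) fun e _ => hcon e
  have hswap : ∑ e, ∑ z ∈ I, F (e + T z) = #I * ∑ y, F y := by
    rw [sum_comm]
    simp only [sum_shift F, sum_const, nsmul_eq_mul]
  rw [← mul_sum, ← mul_sum, hswap] at hlt
  simp [mul_left_comm] at hlt

/-- Every plateaued function is affinely equivalent, up to an affine summand, to one whose spectral
fibres are cheap over the ball. -/
lemma exists_normalForm {m : ℕ} (hm : 4 ≤ m) {g : (Fin (2 * m + 3) → ZMod 2) → ZMod 2}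
    (hg : IsPlat m g) :
    ∃ (B : Fin (2 * m + 3) → Fin (2 * m + 3) → ZMod 2) (u e : Fin (2 * m + 3) → ZMod 2)
      (g₀ : (Fin (2 * m + 3) → ZMod 2) → ZMod 2), IsPlat m g₀ ∧
      10 * ∑ z ∈ ball {0, 1}ᶜ (m + 2), specCost m g₀ 0 1 z ≤
        468 * #(ball ({0, 1}ᶜ : Finset (Fin (2 * m + 3))) (m + 2)) ∧
      g = fun x => g₀ (coords B (x + u)) + ip e (x + u) := by
  obtain ⟨a, b, σ, τ, ha, hb, hab, hcost⟩ := exists_planeCost_le hm hg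
  obtain ⟨B, rfl, rfl⟩ := exists_basis_of_ne ha hb hab
  obtain ⟨u, hu⟩ := (coords_bijective B).2 (Function.update (Function.update 0 0 σ) 1 τ)
  have h01 : (0 : Fin (2 * m + 3)) ≠ 1 := by simp
  have hu0 : ip u (B 0) = σ := by
    have := congrFun hu 0
    simpa [h01, coords] using this
  have hu1 : ip u (B 1) = τ := by
    have := congrFun hu 1
    simpa [coords] using this
  set I := ball ({0, 1}ᶜ : Finset (Fin (2 * m + 3))) (m + 2)
  obtain ⟨e, he⟩ := exists_translate_sum_le I B.equivFun.symm fun y =>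
    fibCost (spec m g y) (sgn σ * spec m g (y + B 0)) (sgn τ * spec m g (y + B 1))
      (sgn (σ + τ) * spec m g (y + (B 0 + B 1)))
  let S := Equiv.ofBijective _ (coords_bijective B)
  have hS : ∀ x, S.symm (coords B x) = x := fun x => S.symm_apply_apply x
  let g₀ : (Fin (2 * m + 3) → ZMod 2) → ZMod 2 := fun z => g (S.symm z + u) + ip e (S.symm z)
  have hg₀ : ∀ x, g₀ (coords B x) = g (x + u) + ip e x := fun x => by
    simp only [g₀, hS]
  obtain ⟨hp, hspec⟩ := spec_coords B hg hg₀
  refine ⟨B, u, e, g₀, hp, ?_, ?_⟩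
  · have hT : ∀ i, B.equivFun.symm (Pi.single i 1) = B i := fun i => by
      rw [Module.Basis.equivFun_symm_apply]
      simp [Pi.single_apply]
    have hfib : ∀ z, specCost m g₀ 0 1 z =
        fibCost (spec m g (e + B.equivFun.symm z))
          (sgn σ * spec m g (e + B.equivFun.symm z + B 0))
          (sgn τ * spec m g (e + B.equivFun.symm z + B 1))
          (sgn (σ + τ) * spec m g (e + B.equivFun.symm z + (B 0 + B 1))) := by
      intro z
      simp only [specCost, hspec, map_add, hT]
      simp only [← add_assoc (e)]
      generalize e + B.equivFun.symm z = y
      simp only [ip_add_right u y, ip_add_right u (B 0), hu0, hu1, sgn_add (ip u y)]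
      rcases sgn_eq_or (ip u y) with h | h
      · simp only [h, one_mul]
      · simp only [h, neg_mul, one_mul, fibCost_neg]
    simp_rw [hfib]
    have hq : (0 : ℤ) < 2 ^ (2 * m + 3) := by positivity
    refine le_of_mul_le_mul_left ?_ hq
    have hI : (0 : ℤ) ≤ #I := by positivity
    have := mul_le_mul_of_nonneg_left hcost hI
    unfold planeCost at this
    linarith
  · funext x
    rw [hg₀, add_assoc, CharTwo.add_self_eq_zero, add_zero, add_assoc, add_self_vec, add_zero]

open Classical in
lemma card_isPlat_le {m : ℕ} (hm : 4 ≤ m) :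
    (#(univ.filter fun g : (Fin (2 * m + 3) → ZMod 2) → ZMod 2 => IsPlat m g) : ℝ) ≤
      2 ^ ((((2 * m + 3) ^ 2 + 2 * (2 * m + 3) : ℕ) : ℝ) +
        3.468 * (#(ball ({0, 1}ᶜ : Finset (Fin (2 * m + 3))) (m + 2)) : ℝ)) := by
  set I := ball ({0, 1}ᶜ : Finset (Fin (2 * m + 3))) (m + 2) with hI
  set A := univ.filter fun g : (Fin (2 * m + 3) → ZMod 2) → ZMod 2 => IsPlat m g ∧
    10 * ∑ z ∈ I, specCost m g 0 1 z ≤ 468 * #I with hA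
  have hA_card : (#A : ℝ) ≤ 2 ^ (3 * (#I : ℝ) + 0.468 * #I) := by
    refine card_le_of_specCost_le 0 1 (by simp) A _ (fun g hg => (mem_filter.1 hg).2.1)
      fun g hg => ?_
    have h := (mem_filter.1 hg).2.2
    have h' : (10 : ℝ) * ((∑ z ∈ I, specCost m g 0 1 z : ℤ) : ℝ) ≤ 468 * #I := by exact_mod_cast h
    linarith
  have hsub : (univ.filter fun g : (Fin (2 * m + 3) → ZMod 2) → ZMod 2 => IsPlat m g) ⊆
      ((univ : Finset ((Fin (2 * m + 3) → Fin (2 * m + 3) → ZMod 2) ×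
        (Fin (2 * m + 3) → ZMod 2) × (Fin (2 * m + 3) → ZMod 2))) ×ˢ A).image
        fun p x => p.2 (coords p.1.1 (x + p.1.2.1)) + ip p.1.2.2 (x + p.1.2.1) := by
    intro g hg
    obtain ⟨B, u, e, g₀, hp, hc, rfl⟩ := exists_normalForm hm (mem_filter.1 hg).2
    exact mem_image.2 ⟨((B, u, e), g₀), mem_product.2 ⟨mem_univ _,
      mem_filter.2 ⟨mem_univ _, hp, hc⟩⟩, rfl⟩
  have hcard := (card_le_card hsub).trans card_image_le
  rw [card_product, card_univ] at hcard
  simp only [Fintype.card_prod, Fintype.card_fun, ZMod.card, Fintype.card_fin] at hcard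
  rw [← pow_mul, ← pow_add, ← pow_add] at hcard
  have hcard' : (#(univ.filter fun g : (Fin (2 * m + 3) → ZMod 2) → ZMod 2 => IsPlat m g) : ℝ) ≤
      2 ^ ((2 * m + 3) ^ 2 + 2 * (2 * m + 3)) * #A := by
    rw [sq, two_mul (2 * m + 3)]
    exact_mod_cast hcard
  refine hcard'.trans ?_
  rw [Real.rpow_add (by norm_num), Real.rpow_natCast]
  refine mul_le_mul_of_nonneg_left (hA_card.trans (le_of_eq ?_)) (by positivity)
  congr 1
  ring

end NormalForm

section Restriction

lemma exists_eq_ip {n : ℕ} (l : (Fin n → ZMod 2) →ₗ[ZMod 2] ZMod 2) : ∃ c, ∀ z, l z = ip z c :=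
  ⟨_, fun z => LinearMap.pi_apply_eq_sum_univ l z⟩

lemma exists_eq_hyperplane {n : ℕ} (H : Submodule (ZMod 2) (Fin (n + 1) → ZMod 2))
    (hH : Module.finrank (ZMod 2) H = n) : ∃ c, ∀ z, z ∈ H ↔ ip z c = 0 := by
  have hlt : H < ⊤ := by
    refine lt_top_iff_ne_top.2 fun h => ?_
    rw [h, finrank_top, Module.finrank_fin_fun] at hH
    omega
  obtain ⟨l, hl, hle⟩ := H.exists_le_ker_of_lt_top hlt
  obtain ⟨c, hc⟩ := exists_eq_ip l
  refine ⟨c, fun z => ?_⟩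
  have hrank := l.finrank_range_add_finrank_ker
  rw [LinearMap.range_eq_top.2 (LinearMap.surjective hl), finrank_top, Module.finrank_self,
    Module.finrank_fin_fun] at hrank
  have : H = LinearMap.ker l := Submodule.eq_of_le_of_finrank_eq hle (by omega)
  rw [this, LinearMap.mem_ker, hc]

lemma isPlat_of_isBent {m : ℕ} {g : (Fin (2 * m + 3) → ZMod 2) → ZMod 2}
    {f : (Fin (2 * m + 3 + 1) → ZMod 2) → ZMod 2} (hf : IsBent f)
    (H : Submodule (ZMod 2) (Fin (2 * m + 3 + 1) → ZMod 2))
    (φ : (Fin (2 * m + 3) → ZMod 2) ≃ₗ[ZMod 2] H) (hH : Module.finrank (ZMod 2) H = 2 * m + 3)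
    (hg : ∀ x, g x = f (φ x)) : IsPlat m g := by
  classical
  intro y
  obtain ⟨c₀, hc₀⟩ := exists_eq_hyperplane H hH
  let l₀ : (Fin (2 * m + 3) → ZMod 2) →ₗ[ZMod 2] ZMod 2 := dotProductBilin (ZMod 2) (ZMod 2) y
  obtain ⟨l, hl⟩ := (l₀ ∘ₗ φ.symm.toLinearMap).exists_extend
  obtain ⟨c, hc⟩ := exists_eq_ip l
  have hφ : ∀ x, ip (φ x : Fin (2 * m + 3 + 1) → ZMod 2) c = ip x y := by
    intro x
    rw [← hc, ip_comm x y]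
    have : l (φ x) = l₀ x := by simpa using LinearMap.congr_fun hl (φ x)
    exact this
  have key : 2 * walsh g y = walsh f c + walsh f (c + c₀) := by
    have h1 : walsh f c + walsh f (c + c₀) =
        ∑ z, if z ∈ H then 2 * (sgn (f z) * sgn (ip z c)) else 0 := by
      rw [walsh_eq, walsh_eq, ← sum_add_distrib]
      refine sum_congr rfl fun z _ => ?_
      rw [ip_add_right, sgn_add]
      have h01 : ∀ t : ZMod 2, t ≠ 0 → sgn t = -1 := by decide
      split_ifs with h
      · rw [(hc₀ z).1 h, sgn_zero]; ring
      · rw [h01 _ fun h' => h ((hc₀ z).2 h')]; ring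
    rw [h1, ← sum_filter, walsh_eq, mul_sum]
    refine sum_bij (fun x _ => (φ x : Fin (2 * m + 3 + 1) → ZMod 2)) (fun x _ => by simp)
      (fun x _ x' _ h => φ.injective (Subtype.ext h)) (fun z hz => ?_) fun x _ => ?_
    · have hz' : z ∈ H := by simpa using hz
      exact ⟨φ.symm ⟨z, hz'⟩, mem_univ _, by simp⟩
    · rw [hφ, hg]
  have he : (2 * m + 3 + 1) / 2 = m + 2 := by omega
  have h1 := hf c
  have h2 := hf (c + c₀)
  rw [he] at h1 h2
  rcases h1 with h1 | h1 <;> rcases h2 with h2 | h2 <;> rw [h1, h2] at key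
  · right; left; linarith
  · left; linarith
  · left; linarith
  · right; right; linarith

end Restriction

section Asymptotics

lemma centralBinom_sq_mul_le (k : ℕ) : Nat.centralBinom k ^ 2 * (2 * k + 1) ≤ 16 ^ k := by
  induction k with
  | zero => simp
  | succ k ih =>
    have h := Nat.succ_mul_centralBinom_succ k
    have hpos : 0 < (k + 1) ^ 2 := by positivity
    refine Nat.le_of_mul_le_mul_left ?_ hpos
    calc (k + 1) ^ 2 * (Nat.centralBinom (k + 1) ^ 2 * (2 * (k + 1) + 1))
        = ((k + 1) * Nat.centralBinom (k + 1)) ^ 2 * (2 * k + 3) := by ring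
      _ = (Nat.centralBinom k ^ 2 * (2 * k + 1)) * (4 * ((2 * k + 1) * (2 * k + 3))) := by
          rw [h]; ring
      _ ≤ 16 ^ k * (4 * (4 * (k + 1) ^ 2)) := Nat.mul_le_mul ih (by nlinarith)
      _ = (k + 1) ^ 2 * 16 ^ (k + 1) := by ring

lemma card_ball_le {m : ℕ} :
    #(ball ({0, 1}ᶜ : Finset (Fin (2 * m + 3))) (m + 2)) ≤
      4 ^ m + 2 * Nat.centralBinom (m + 1) := by
  have hR : #({0, 1}ᶜ : Finset (Fin (2 * m + 3))) = 2 * m + 1 := by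
    rw [card_compl, card_pair (by simp), Fintype.card_fin]; omega
  set R : Finset (Fin (2 * m + 3)) := {0, 1}ᶜ
  have h1 : #(ball R (m + 2)) ≤ #((range (m + 3)).biUnion fun i => R.powersetCard i) := by
    refine card_le_card_of_injOn supp (fun z hz => ?_) supp_injective.injOn
    obtain ⟨hz1, hz2⟩ := mem_ball.1 hz
    exact mem_biUnion.2 ⟨_, mem_range.2 (by omega),
      mem_powersetCard.2 ⟨mem_cube_iff_supp.1 hz1, rfl⟩⟩
  refine h1.trans (card_biUnion_le.trans ?_)
  simp_rw [card_powersetCard, hR]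
  rw [sum_range_succ, sum_range_succ, Nat.sum_range_choose_halfway]
  have h2 : ∀ i, (2 * m + 1).choose i ≤ Nat.centralBinom (m + 1) := fun i =>
    (Nat.choose_le_choose i (by omega)).trans (Nat.choose_le_centralBinom i (m + 1))
  have := h2 (m + 1)
  have := h2 (m + 2)
  omega

lemma eventually_exponent_le {ε : ℝ} (hε : 0 < ε) : ∀ᶠ m : ℕ in Filter.atTop,
    (((2 * m + 3) ^ 2 + 2 * (2 * m + 3) : ℕ) : ℝ) +
      3.468 * (4 ^ m + 2 * (Nat.centralBinom (m + 1) : ℝ)) ≤ (3.47 + ε) * 4 ^ m := by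
  have h1 : Filter.Tendsto (fun m : ℕ => (m : ℝ) ^ 2 / 4 ^ m) Filter.atTop (nhds 0) :=
    tendsto_pow_const_div_const_pow_of_one_lt 2 (by norm_num)
  have h2 : Filter.Tendsto (fun m : ℕ => (m : ℝ)) Filter.atTop Filter.atTop :=
    tendsto_natCast_atTop_atTop
  filter_upwards [h1.eventually_lt_const (show (0 : ℝ) < ε / 70 by positivity),
    h2.eventually_ge_atTop (10000 / ε ^ 2), Filter.eventually_ge_atTop 1] with m hm1 hm2 hm3
  have hm3' : (1 : ℝ) ≤ m := by exact_mod_cast hm3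
  have h4 : (0 : ℝ) < 4 ^ m := by positivity
  rw [div_lt_iff₀ h4] at hm1
  have hbin : (Nat.centralBinom (m + 1) : ℝ) ≤ ε / 20 * 4 ^ m := by
    have h := centralBinom_sq_mul_le (m + 1)
    have h' : (Nat.centralBinom (m + 1) : ℝ) ^ 2 * (2 * (m + 1) + 1) ≤ 16 * (4 ^ m) ^ 2 := by
      have : (16 : ℝ) ^ (m + 1) = 16 * (4 ^ m) ^ 2 := by
        rw [pow_succ, ← pow_mul, mul_comm m 2, pow_mul]; norm_num; ring
      rw [← this]; exact_mod_cast h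
    rw [div_le_iff₀ (by positivity)] at hm2
    refine le_of_sq_le_sq ?_ (by positivity)
    have hpos : (0 : ℝ) < 2 * (m + 1) + 1 := by positivity
    refine le_of_mul_le_mul_right (h'.trans ?_) hpos
    have : 16 ≤ (ε / 20) ^ 2 * (2 * ((m : ℝ) + 1) + 1) := by nlinarith [sq_nonneg ε]
    calc (16 : ℝ) * (4 ^ m) ^ 2 ≤ ((ε / 20) ^ 2 * (2 * ((m : ℝ) + 1) + 1)) * (4 ^ m) ^ 2 := by
          gcongr
      _ = _ := by ring
  push_cast
  nlinarith

end Asymptotics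

/-- Asymptotic upper bound `𝒩₀(n,1) < 3.47·2^{n-3}·(1 + o(1))`. -/
theorem logNumRestrictedBent_le :
    ∀ ε > (0 : ℝ), ∃ N : ℕ, ∀ n ≥ N, n % 2 = 1 →
      logNumRestrictedBent n ≤ (3.47 + ε) * 2 ^ (n - 3) := by
  classical
  intro ε hε
  obtain ⟨M, hM⟩ := Filter.eventually_atTop.1 (eventually_exponent_le hε)
  refine ⟨2 * (M + 4) + 3, fun n hn hodd => ?_⟩
  obtain ⟨m, rfl⟩ : ∃ m, n = 2 * m + 3 := ⟨(n - 3) / 2, by omega⟩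
  have hexp := hM m (by omega)
  have hsub : 2 * m + 3 - 3 = 2 * m := by omega
  have h24 : (2 : ℝ) ^ (2 * m) = 4 ^ m := by rw [pow_mul]; norm_num
  rw [hsub, h24, logNumRestrictedBent]
  have hpos : 0 ≤ (3.47 + ε) * (4 : ℝ) ^ m := by positivity
  set c := Nat.card _ with hc
  rcases Nat.eq_zero_or_pos c with h0 | h0
  · rw [h0, Nat.cast_zero, Real.logb_zero]; exact hpos
  rw [Real.logb_le_iff_le_rpow (by norm_num) (by exact_mod_cast h0)]
  have hle : c ≤ #(univ.filter fun g : (Fin (2 * m + 3) → ZMod 2) → ZMod 2 => IsPlat m g) := by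
    rw [hc, Nat.card_eq_fintype_card, Fintype.card_subtype]
    refine card_le_card fun g hg => ?_
    obtain ⟨f, H, φ, hf, hH, hgf⟩ := (mem_filter.1 hg).2
    exact mem_filter.2 ⟨mem_univ _, isPlat_of_isBent hf H φ hH hgf⟩
  have hball : (#(ball ({0, 1}ᶜ : Finset (Fin (2 * m + 3))) (m + 2)) : ℝ) ≤
      4 ^ m + 2 * (Nat.centralBinom (m + 1) : ℝ) := by exact_mod_cast card_ball_le
  calc (c : ℝ) ≤ _ := Nat.cast_le.2 hle
    _ ≤ _ := card_isPlat_le (by omega)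
    _ ≤ 2 ^ ((3.47 + ε) * (4 : ℝ) ^ m) :=
        Real.rpow_le_rpow_of_exponent_le (by norm_num) (by linarith)
end
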